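/- Let γ be a 3-cycle of (O₆, ℤ×O₆) whose length l = l(γ) satisfies 1 ≤ l ≤ 7 and such that η(π(γ)) ≠ 0. Then γ or its reverse γ̄ (a 3-cycle of (O̅₆, ℤ×O̅₆), where O̅₆ is the dual quandle) satisfies one of the following, where n denotes its minimal degree: (A) 4 ≤ l ≤ 7 and |T_n| = l; (B) 6 ≤ l ≤ 7, |T_n| = 2 and |T_{n+1}| = l − 2; (C) 6 ≤ l ≤ 7, |T_n| = 3 and |T_{n+1}| = l − 3. -/

import Mathlib

namespace QHom

variable {X S : Type*}

/-- Generating tuples: an element of `S` together with a list of quandle elements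
whose consecutive entries are distinct. -/
abbrev Gen (X S : Type*) := {p : S × List X // p.2.Chain' (· ≠ ·)}

/-- The chain group: the free abelian group on `Gen X S`. -/
abbrev Ch (X S : Type*) := Gen X S →₀ ℤ

/-- The basis chain associated to a tuple; `0` if two consecutive entries coincide. -/
noncomputable def gen (s : S) (l : List X) : Ch X S := by
  classical
  exact if h : l.Chain' (· ≠ ·) then Finsupp.single ⟨(s, l), h⟩ 1 else 0

noncomputable def fOn (t : Gen X S) : Ch X S :=
  ∑ j : Fin t.1.2.length, ((-1 : ℤ) ^ ((j : ℕ) + 1)) • gen t.1.1 (t.1.2.eraseIdx (j : ℕ))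

/-- The map `f`. -/
noncomputable def fmap (γ : Ch X S) : Ch X S := γ.sum fun t c => c • fOn t

noncomputable def gOn (op : X → X → X) (sact : S → X → S) (t : Gen X S) : Ch X S :=
  ∑ j : Fin t.1.2.length,
    ((-1 : ℤ) ^ (j : ℕ)) •
      gen (sact t.1.1 (t.1.2.get j))
        ((t.1.2.take (j : ℕ)).map (fun x => op x (t.1.2.get j)) ++ t.1.2.drop ((j : ℕ) + 1))

/-- The map `g`. -/
noncomputable def gmap (op : X → X → X) (sact : S → X → S) (γ : Ch X S) : Ch X S :=
  γ.sum fun t c => c • gOn op sact t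

/-- The boundary map `∂ = f + g`. -/
noncomputable def bd (op : X → X → X) (sact : S → X → S) (γ : Ch X S) : Ch X S :=
  fmap γ + gmap op sact γ

/-- `γ` is an `m`-chain: it is supported on tuples of length `m`. -/
def IsMChain (m : ℕ) (γ : Ch X S) : Prop := ∀ t ∈ γ.support, t.1.2.length = m

/-- The length of a chain: the sum of the absolute values of its coefficients. -/
noncomputable def chainLen (γ : Ch X S) : ℕ := γ.sum fun _ c => c.natAbs

/-- `π` : forget the `S`-coordinate. -/
noncomputable def proj (γ : Ch X S) : Ch X Unit := γ.sum fun t c => c • gen () t.1.2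

/-- Evaluation of a cochain (given by its values on generating tuples) on a chain. -/
noncomputable def evalCh {A : Type*} [AddCommGroup A] (θ : List X → A) (δ : Ch X Unit) : A :=
  δ.sum fun t c => c • θ t.1.2

/-- The action of quandle generators on the `X`-set `ℤ × X`. -/
def zact (op : X → X → X) (s : ℤ × X) (a : X) : ℤ × X := (s.1 + 1, op s.2 a)

/-- `γ` is a 3-term of degree `n` and index `u`. -/
def IsTerm3 (γ : Ch X (ℤ × X)) (n : ℤ) (u : X) : Prop :=
  ∃ ε a b c, (ε = (1 : ℤ) ∨ ε = -1) ∧ a ≠ b ∧ b ≠ c ∧ γ = ε • gen (n, u) [a, b, c]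

def Efficient {k : ℕ} (γ : Fin k → Ch X S) : Prop := ∀ i j, i ≠ j → γ i ≠ -γ j

def FConnected {k : ℕ} (γ : Fin k → Ch X S) : Prop :=
  Efficient γ ∧ (∑ i, fmap (γ i)) = 0 ∧
    ∀ I : Finset (Fin k), I.Nonempty → I ≠ Finset.univ → (∑ i ∈ I, fmap (γ i)) ≠ 0

def GConnected {k : ℕ} (op : X → X → X) (sact : S → X → S) (γ : Fin k → Ch X S) : Prop :=
  Efficient γ ∧ (∑ i, gmap op sact (γ i)) = 0 ∧
    ∀ I : Finset (Fin k), I.Nonempty → I ≠ Finset.univ → (∑ i ∈ I, gmap op sact (γ i)) ≠ 0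

/-- `n` is the minimal degree of `γ`. -/
def MinDegree (γ : Ch X (ℤ × X)) (n : ℤ) : Prop :=
  (∃ t ∈ γ.support, t.1.1.1 = n) ∧ ∀ t ∈ γ.support, n ≤ t.1.1.1

/-- `|T_k(γ)|`: the number of terms (with multiplicity) of `γ` of degree `k`. -/
noncomputable def Tcount (γ : Ch X (ℤ × X)) (k : ℤ) : ℕ :=
  γ.sum fun t c => if t.1.1.1 = k then c.natAbs else 0

def revList (op : X → X → X) : List X → List X
  | [] => []
  | a :: l => l.foldl op a :: revList op l

/-- The reverse of a chain of `(X, ℤ × X)` (a chain of the dual quandle). -/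
noncomputable def reverse (op : X → X → X) (γ : Ch X (ℤ × X)) : Ch X (ℤ × X) :=
  γ.sum fun t c => c • gen (-t.1.1.1, t.1.2.foldl op t.1.1.2) (revList op t.1.2)

/-- The degree-shift automorphism `σ`. -/
noncomputable def sigmaMap (γ : Ch X (ℤ × X)) : Ch X (ℤ × X) :=
  γ.sum fun t c => c • gen (t.1.1.1 + 1, t.1.1.2) t.1.2

/-- `γ` is a 3-term of type `ty` with respect to the operation `op`. -/
def IsTypedTerm (op : X → X → X) (γ : Ch X (ℤ × X)) (ty : ℕ) : Prop :=
  ∃ (ε n : ℤ) (u a b c : X), (ε = 1 ∨ ε = -1) ∧ a ≠ b ∧ b ≠ c ∧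
    γ = ε • gen (n, u) [a, b, c] ∧
    ((ty = 0 ∧ a = c ∧ op a b = c) ∨ (ty = 1 ∧ a = c ∧ op a b ≠ c) ∨
      (ty = 2 ∧ a ≠ c ∧ op a b = c) ∨ (ty = 3 ∧ a ≠ c ∧ op a b ≠ c))

/-- A bigon 3-term `⟨x, y⟩` of degree `n` and index `u`. -/
def IsBigon (n : ℤ) (u x y : X) (δ : Ch X (ℤ × X)) : Prop :=
  δ = gen (n, u) [x, y, x] ∨ δ = gen (n, u) [y, x, y]

/-- The case shapes (A), (B), (C). -/
def Shape (δ : Ch X (ℤ × X)) (n : ℤ) (l : ℕ) : Prop :=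
  (4 ≤ l ∧ l ≤ 7 ∧ Tcount δ n = l) ∨
  (6 ≤ l ∧ l ≤ 7 ∧ Tcount δ n = 2 ∧ Tcount δ (n + 1) = l - 2) ∨
  (6 ≤ l ∧ l ≤ 7 ∧ Tcount δ n = 3 ∧ Tcount δ (n + 1) = l - 3)

/-- A quandle structure on `X`. -/
structure QuandleStr (X : Type*) where
  op : X → X → X
  idem : ∀ a, op a a = a
  bij : ∀ b, Function.Bijective fun a => op a b
  dist : ∀ a b c, op (op a b) c = op (op a c) (op b c)

/-- The dual quandle operation. -/
noncomputable def dualOp (Q : QuandleStr X) : X → X → X :=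
  fun a b => (Equiv.ofBijective (fun x => Q.op x b) (Q.bij b)).symm a

/-- An `X`-set: a set with a right action of the associated group `G(X)`, recorded via its
action of the generators, which is bijective generator-wise and compatible with the
defining relations of `G(X)`. -/
structure QSet (X : Type*) (op : X → X → X) (S : Type*) where
  sact : S → X → S
  bij : ∀ a, Function.Bijective fun s => sact s a
  comm : ∀ s a b, sact (sact s a) b = sact (sact s b) (op a b)

/-- The 7-dihedral quandle operation on `ZMod 7`. -/
def R7op : ZMod 7 → ZMod 7 → ZMod 7 := fun a b => 2 * b - a

def zetaInt (a b c : ℤ) : ℤ := (a - b) * ((b ^ 7 + (2 * c - b) ^ 7 - 2 * c ^ 7) / 7)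

/-- The Mochizuki 3-cocycle on triples. -/
def zetaFun (a b c : ZMod 7) : ZMod 7 := (zetaInt a.val b.val c.val : ℤ)

def zetaL : List (ZMod 7) → ZMod 7
  | [a, b, c] => zetaFun a b c
  | _ => 0

/-- The octahedral quandle operation on `Fin 6`: `octAct a b = σ_b(a)`. -/
def octAct : Fin 6 → Fin 6 → Fin 6 := fun a b =>
  ![![0, 2, 4, 3, 5, 1],
    ![5, 1, 0, 2, 4, 3],
    ![1, 3, 2, 4, 0, 5],
    ![0, 5, 1, 3, 2, 4],
    ![2, 1, 3, 5, 4, 0],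
    ![4, 0, 2, 1, 3, 5]] b a

/-- `σ₀`, the rotation about the axis through `0` and `3`. -/
def sig0 : Fin 6 → Fin 6 := fun a => octAct a 0

def etaTriples1 : List (Fin 6 × Fin 6 × Fin 6) :=
  [(0, 1, 2), (0, 3, 1), (1, 2, 0), (1, 4, 2), (3, 1, 5)]

def etaTriples2 : List (Fin 6 × Fin 6 × Fin 6) :=
  [(0, 1, 5), (1, 0, 1), (1, 0, 5), (1, 2, 1), (1, 3, 1), (1, 3, 2), (1, 4, 5), (1, 5, 1),
    (3, 0, 1), (3, 1, 0), (3, 1, 2)]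

/-- The 3-cocycle `η` of the octahedral quandle, on triples. -/
noncomputable def etaFun (a b c : Fin 6) : ZMod 3 := by
  classical
  exact
    if ∃ k : ℕ, ∃ p ∈ etaTriples1, a = sig0^[k] p.1 ∧ b = sig0^[k] p.2.1 ∧ c = sig0^[k] p.2.2
      then 1
    else if ∃ k : ℕ, ∃ p ∈ etaTriples2, a = sig0^[k] p.1 ∧ b = sig0^[k] p.2.1 ∧ c = sig0^[k] p.2.2
      then 2
    else 0

noncomputable def etaL : List (Fin 6) → ZMod 3
  | [a, b, c] => etaFun a b c
  | _ => 0

namespace Search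

/-- Apply `f` to the predecessor of `n`, forcing the kernel to evaluate `n` first. -/
def strict (n : ℕ) (f : ℕ → Bool) : Bool := Nat.rec (f 0) (fun m _ => f m) n

/-- Insert `h` in a list of signed keys, or cancel one occurrence of its opposite `h'`. -/
def insK (h h' : ℕ) (r : List ℕ) : (List ℕ → Bool) → Bool :=
  List.rec (fun k => k [h])
    (fun x t ih k => cond (Nat.beq x h') (k t) (ih fun t' => k (x :: t'))) r

/-- Perform `insK` in the `j`-th layer. -/
def modK (h h' : ℕ) (R : List (List ℕ)) : ℕ → (List (List ℕ) → Bool) → Bool :=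
  List.rec (fun _ _ => false) (fun r rest ih j k =>
    Nat.rec (insK h h' r fun r' => k (r' :: rest))
      (fun j' _ => ih j' fun rest' => k (r :: rest')) j) R

def lenLe (r : List ℕ) : ℕ → Bool :=
  List.rec (fun _ => true) (fun _ _ ih n => Nat.rec false (fun m _ => ih m) n) r

def layer (R : List (List ℕ)) : ℕ → List ℕ :=
  List.rec (fun _ => []) (fun r _ ih j => Nat.rec r (fun j' _ => ih j') j) R

def budget (b : List ℕ) : ℕ → ℕ :=
  List.rec (fun _ => 0) (fun b₀ _ ih j => Nat.rec b₀ (fun j' _ => ih j') j) b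

/-- The residual in layer `l` is small enough to be cancelled within the budget `b`. -/
def fitAt (R : List (List ℕ)) (b : List ℕ) (l : ℕ) : Bool :=
  lenLe (layer R l)
    (Nat.mul 3 (Nat.add (budget b l) (Nat.rec 0 (fun l' _ => budget b l') l)))

/-- Call `k` on the first nonempty layer and its head, or return `kn` if there is none. -/
def pickFirst (R : List (List ℕ)) (k : ℕ → ℕ → Bool) (kn : Bool) : ℕ → Bool :=
  List.rec (fun _ => kn)
    (fun r _ ih l => List.rec (ih (Nat.succ l)) (fun h _ _ => strict (Nat.succ l) fun l => k l h) r) R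

/-- Call `k` on the last nonempty layer and its head, or return `kn` if there is none. -/
def pickLast (R : List (List ℕ)) (k : ℕ → ℕ → Bool) : Bool → ℕ → Bool :=
  List.rec (fun kn _ => kn)
    (fun r _ ih kn l =>
      ih (List.rec kn (fun h _ _ => strict (Nat.succ l) fun l => k l h) r) (Nat.succ l)) R

/-- Decrease the `j`-th budget; succeed if it is exhausted. -/
def decK (b : List ℕ) : ℕ → (List ℕ → Bool) → Bool :=
  List.rec (fun _ _ => true) (fun b₀ b' ih j k =>
    Nat.rec (Nat.rec true (fun m _ => k (m :: b')) b₀)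
      (fun j' _ => ih j' fun b'' => k (b₀ :: b'')) j) b

/-- `octAct`, on natural numbers. -/
def opA (a b : ℕ) : ℕ :=
  Nat.land (Nat.shiftRight 218833227041522235194556271613712 (Nat.mul 3 (Nat.add (Nat.mul 6 b) a))) 7

/-- The inverse operation of `opA`. -/
def opI (a b : ℕ) : ℕ :=
  Nat.land (Nat.shiftRight 205549348559836869186240241084008 (Nat.mul 3 (Nat.add (Nat.mul 6 b) a))) 7

/-- `etaFun`, on natural numbers. -/
def etaN (a b c : ℕ) : ℕ :=
  Nat.land (Nat.shiftRight
    1354174463542915131038614077235836308838426700880075846829158173663736719370130686556569161374342405267608044677375166792138752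
    (Nat.mul 2 (Nat.add (Nat.mul 36 a) (Nat.add (Nat.mul 6 b) c)))) 3

def keyN (u a b : ℕ) : ℕ := Nat.add (Nat.mul 36 u) (Nat.add (Nat.mul 6 a) b)

/-- Add the key `(u, a, b)` with sign `s` to layer `l` of the residual. -/
def addKey (s l u a b : ℕ) (R : List (List ℕ)) (k : List (List ℕ) → Bool) : Bool :=
  cond (Nat.beq a b) (k R) <|
  strict (Nat.succ (keyN u a b)) fun h₀ =>
  strict (Nat.succ (Nat.add (Nat.mul 216 s) h₀)) fun h =>
  strict (Nat.succ (Nat.add (Nat.mul 216 (Nat.sub 1 s)) h₀)) fun h' =>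
  modK h h' R l k

/-- Subtract the `f`-boundary of a signed term of layer `j`. -/
def addF (j s s' u a b c : ℕ) (R : List (List ℕ)) (k : List (List ℕ) → Bool) : Bool :=
  addKey s j u b c R fun R => addKey s' j u a c R fun R => addKey s j u a b R k

/-- Subtract the `g`-boundary of a signed term of layer `j`, where `j' = j + 1`. -/
def addG (j' s s' u a b c : ℕ) (R : List (List ℕ)) (k : List (List ℕ) → Bool) : Bool :=
  addKey s' j' (opA u a) b c R fun R => addKey s j' (opA u b) (opA a b) c R fun R =>
    addKey s' j' (opA u c) (opA a c) (opA b c) R k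

/-- Subtract the boundary of a signed term, with early exit if the residual gets too large. -/
def addTerm (lo hi j s u a b c : ℕ) (R : List (List ℕ)) (bud : List ℕ)
    (k : List (List ℕ) → Bool) : Bool :=
  strict (Nat.succ (Nat.sub 1 s)) fun s' => strict (Nat.succ (Nat.succ j)) fun j' =>
  let kG := fun R => cond (Nat.ble j' hi)
    (addG j' s s' u a b c R fun R => cond (fitAt R bud j') (k R) true) (k R)
  cond (Nat.ble lo j) (addF j s s' u a b c R fun R => cond (fitAt R bud j) (kG R) true) (kG R)

def allLt (f : ℕ → Bool) : Bool :=
  and (f 0) (and (f 1) (and (f 2) (and (f 3) (and (f 4) (f 5)))))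

/-- A signed term: layer, sign, index and the three entries. -/
structure Code where
  (j s u a b c : ℕ)

/-- Words in the quandle generators representing all rotations of the octahedron. -/
def words : List (List ℕ) :=
  [[], [5], [1], [1, 1], [2], [4], [0], [5, 0], [1, 0], [1, 1, 0], [2, 0], [4, 0],
    [0, 0], [5, 0, 0], [1, 0, 0], [1, 1, 0, 0], [2, 0, 0], [4, 0, 0],
    [0, 0, 0], [5, 0, 0, 0], [1, 0, 0, 0], [1, 1, 0, 0, 0], [2, 0, 0, 0], [4, 0, 0, 0]]

def rotN (w : List ℕ) (a : ℕ) : ℕ := w.foldl opA a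

def etaSum (w : List ℕ) (cur : List Code) : ℕ :=
  List.rec 0 (fun x _ ih =>
    Nat.add (Nat.mul (Nat.succ x.s) (etaN (rotN w x.a) (rotN w x.b) (rotN w x.c))) ih) cur

def leafOk (lo hi : ℕ) (cur : List Code) : Bool :=
  and (cur.all fun x => and (Nat.ble lo x.j) (Nat.ble (Nat.succ x.j) hi))
    (words.all fun w => Nat.beq (Nat.mod (etaSum w cur) 3) 0)

/-- Continue the search after adding a term, unless the term is degenerate. -/
def extend (lo hi : ℕ) (next : List (List ℕ) → List ℕ → List Code → Bool) (R : List (List ℕ))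
    (cur : List Code) (j : ℕ) (bud : List ℕ) (s u a b c : ℕ) : Bool :=
  cond (Nat.beq a b) true <| cond (Nat.beq b c) true <|
    addTerm lo hi j s u a b c R bud fun R' => next R' bud (⟨j, s, u, a, b, c⟩ :: cur)

/-- Continue the search with all terms whose boundary cancels the signed key `h` of layer `l`. -/
def branch (lo hi : ℕ) (next : List (List ℕ) → List ℕ → List Code → Bool) (R : List (List ℕ))
    (bud : List ℕ) (cur : List Code) (l h : ℕ) : Bool :=
  strict (Nat.succ (Nat.div h 216)) fun s => strict (Nat.succ (Nat.sub 1 s)) fun s' =>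
  strict (Nat.succ (Nat.mod (Nat.div h 36) 6)) fun v =>
  strict (Nat.succ (Nat.mod (Nat.div h 6) 6)) fun p =>
  strict (Nat.succ (Nat.mod h 6)) fun q =>
  and (and (Nat.ble lo l) (Nat.ble l hi)) <|
  and (decK bud l fun bud' => allLt fun x =>
      and (extend lo hi next R cur l bud' s' v x p q)
        (and (extend lo hi next R cur l bud' s v p x q) (extend lo hi next R cur l bud' s' v p q x)))
    (Nat.rec true (fun j _ => decK bud j fun bud' => allLt fun x =>
      strict (Nat.succ (opI v x)) fun u => strict (Nat.succ (opI p x)) fun px =>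
      strict (Nat.succ (opI q x)) fun qx =>
      and (extend lo hi next R cur j bud' s u x p q)
        (and (extend lo hi next R cur j bud' s' u px x q)
          (extend lo hi next R cur j bud' s u px qx x))) l)

/-- Depth-first search: every chain within the budget `bud` which completes the chosen terms
`cur`, with residual boundary `R`, contains a nonzero subcycle of weight zero. Only the layers
`lo, …, hi` of the boundary are considered. -/
def dfs (last : Bool) (lo hi fuel : ℕ) : List (List ℕ) → List ℕ → List Code → Bool :=
  Nat.rec (fun _ _ _ => false) (fun _ ih R bud cur =>
    cond last (pickLast R (branch lo hi ih R bud cur) (leafOk lo hi cur) 0)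
      (pickFirst R (branch lo hi ih R bud cur) (leafOk lo hi cur) 0)) fuel

/-- Representatives of the terms of index `0` up to rotations fixing `0`. -/
def starts : List (ℕ × ℕ × ℕ) :=
  [(0, 1, 0), (0, 1, 2), (0, 1, 3), (0, 1, 4), (0, 1, 5), (0, 3, 0), (0, 3, 1),
    (3, 1, 0), (3, 1, 2), (3, 1, 3), (3, 1, 4), (3, 1, 5), (3, 0, 3), (3, 0, 1),
    (1, 0, 1), (1, 0, 2), (1, 0, 3), (1, 0, 4), (1, 0, 5),
    (1, 2, 0), (1, 2, 1), (1, 2, 3), (1, 2, 4), (1, 2, 5),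
    (1, 3, 0), (1, 3, 1), (1, 3, 2), (1, 3, 4), (1, 3, 5),
    (1, 4, 0), (1, 4, 1), (1, 4, 2), (1, 4, 3), (1, 4, 5),
    (1, 5, 0), (1, 5, 1), (1, 5, 2), (1, 5, 3), (1, 5, 4)]

/-- Run the search from all representatives of terms of layer `j`. -/
def run (last : Bool) (lo hi j : ℕ) (bud : List ℕ) : Bool :=
  starts.all fun t => decK bud j fun bud' =>
    addTerm lo hi j 0 0 t.1 t.2.1 t.2.2 [[], [], [], []] bud' fun R =>
      dfs last lo hi 8 R bud' [⟨j, 0, 0, t.1, t.2.1, t.2.2⟩]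

theorem run_single_degree : run false 0 1 0 [5] = true := by decide +kernel

theorem run_first_single : run false 0 0 0 [1] = true := by decide +kernel

theorem run_last_single : run true 1 1 0 [1] = true := by decide +kernel

theorem run_first_pair : run false 0 1 0 [3, 1] = true := by decide +kernel

theorem run_last_pair : run true 1 2 1 [1, 3] = true := by decide +kernel

theorem run_two_two_three : run false 0 3 0 [2, 2, 3] = true := by decide +kernel

theorem run_two_three_two : run false 0 3 0 [2, 3, 2] = true := by decide +kernel

theorem run_three_two_two : run true 0 3 2 [3, 2, 2] = true := by decide +kernel

theorem run_three_two : run true 0 2 1 [3, 2] = true := by decide +kernel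

open Multiset

/-- A signed term `±(d, u; a, b, c)`; the sign is negative if `s` is `true`. -/
structure STerm where
  (d : ℤ) (s : Bool) (u a b c : Fin 6)
deriving DecidableEq

/-- The keys index the tuples `(u; p, q)`, as potential boundary terms in a given degree. -/
abbrev Key := Fin 6 × Fin 6 × Fin 6

def sg (s : Bool) : ℤ := if s then -1 else 1

def ind (u a b : Fin 6) (K : Key) : ℤ := if a ≠ b ∧ (u, a, b) = K then 1 else 0

def fCoef (x : STerm) (K : Key) : ℤ :=
  -ind x.u x.b x.c K + ind x.u x.a x.c K - ind x.u x.a x.b K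

def gCoef (x : STerm) (K : Key) : ℤ :=
  ind (octAct x.u x.a) x.b x.c K - ind (octAct x.u x.b) (octAct x.a x.b) x.c K
    + ind (octAct x.u x.c) (octAct x.a x.c) (octAct x.b x.c) K

/-- The coefficient of `(e, K)` in the boundary of `x`. -/
def coef (x : STerm) (e : ℤ) (K : Key) : ℤ :=
  sg x.s * (if x.d = e then fCoef x K else if x.d + 1 = e then gCoef x K else 0)

/-- The coefficient of `(e, K)` in the boundary of the sum of `L`. -/
def cf (L : Multiset STerm) (e : ℤ) (K : Key) : ℤ := (L.map fun x => coef x e K).sum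

def IsCyc (L : Multiset STerm) : Prop := ∀ e K, cf L e K = 0

def STerm.Valid (x : STerm) : Prop := x.a ≠ x.b ∧ x.b ≠ x.c

/-- The number of terms of degree `d`. -/
def num (L : Multiset STerm) (d : ℤ) : ℕ := L.countP fun x => x.d = d

@[simp] theorem cf_zero (e : ℤ) (K : Key) : cf 0 e K = 0 := rfl

@[simp] theorem cf_cons (x : STerm) (L : Multiset STerm) (e : ℤ) (K : Key) :
    cf (x ::ₘ L) e K = coef x e K + cf L e K := by simp [cf]

@[simp] theorem cf_add (L M : Multiset STerm) (e : ℤ) (K : Key) :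
    cf (L + M) e K = cf L e K + cf M e K := by simp [cf]

/-- The code of a key. -/
def Key.code (K : Key) : ℕ := keyN K.1 K.2.1 K.2.2

theorem keyN_eq (u a b : ℕ) : keyN u a b = 36 * u + (6 * a + b) := rfl

theorem Key.code_lt (K : Key) : K.code < 216 := by
  obtain ⟨u, a, b⟩ := K
  simp only [Key.code, keyN_eq]; omega

theorem Key.code_inj {K K' : Key} : K.code = K'.code ↔ K = K' := by
  obtain ⟨u, a, b⟩ := K
  obtain ⟨u', a', b'⟩ := K'
  simp only [Key.code, keyN_eq, Prod.mk.injEq, Fin.ext_iff]; omega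

/-- The code of a key with a sign. -/
def sCode (s : Bool) (K : Key) : ℕ := 216 * s.toNat + K.code

theorem sCode_inj {s s' : Bool} {K K' : Key} : sCode s K = sCode s' K' ↔ s = s' ∧ K = K' := by
  have h₁ := K.code_lt
  have h₂ := K'.code_lt
  rw [← Key.code_inj]
  cases s <;> cases s' <;> simp [sCode] <;> omega

/-- The multiplicity of a key in a list of signed keys. -/
def mult (r : List ℕ) (K : Key) : ℤ := r.count (sCode false K) - r.count (sCode true K)

/-- A list of signed keys without cancelling pairs. -/
def Red (r : List ℕ) : Prop :=
  ∀ h ∈ r, ∃ s K, h = sCode s K ∧ sCode (!s) K ∉ r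

def ins (h h' : ℕ) (r : List ℕ) : List ℕ := if h' ∈ r then r.erase h' else r ++ [h]

theorem insK_eq (h h' : ℕ) (r : List ℕ) (k : List ℕ → Bool) :
    insK h h' r k = k (ins h h' r) := by
  induction r generalizing k with
  | nil => simp [insK, ins]
  | cons x t ih =>
    have : insK h h' (x :: t) k =
      cond (Nat.beq x h') (k t) (insK h h' t fun t' => k (x :: t')) := rfl
    rw [this, ih]
    by_cases hx : x = h'
    · subst hx; simp [ins]
    · have : Nat.beq x h' = false := by
        rw [← Bool.not_eq_true, Nat.beq_eq]; exact hx
      rw [this]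
      simp only [cond_false, ins, List.mem_cons, Ne.symm hx, false_or]
      split <;> simp [hx]

theorem mult_ins (s : Bool) (K K' : Key) (r : List ℕ) :
    mult (ins (sCode s K) (sCode (!s) K) r) K' = mult r K' + if K = K' then sg s else 0 := by
  unfold ins mult
  by_cases hm : sCode (!s) K ∈ r
  · have := List.count_pos_iff.2 hm
    simp only [hm, if_true, List.count_erase, beq_iff_eq, sCode_inj]
    cases s <;> simp_all [sg] <;> split <;> simp_all <;> omega
  · simp only [hm, if_false, List.count_append, List.count_singleton, beq_iff_eq, sCode_inj]
    cases s <;> simp_all [sg] <;> split <;> simp_all <;> omega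

theorem Red.ins {r : List ℕ} (hr : Red r) (s : Bool) (K : Key) :
    Red (ins (sCode s K) (sCode (!s) K) r) := by
  unfold Search.ins
  split_ifs with hm
  · intro h hh
    obtain ⟨s', K', rfl, h'⟩ := hr h (List.mem_of_mem_erase hh)
    exact ⟨s', K', rfl, fun h₂ => h' (List.mem_of_mem_erase h₂)⟩
  · intro h hh
    rcases List.mem_append.1 hh with h₁ | h₁
    · obtain ⟨s', K', rfl, h'⟩ := hr h h₁
      refine ⟨s', K', rfl, fun h₂ => ?_⟩
      rcases List.mem_append.1 h₂ with h₂ | h₂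
      · exact h' h₂
      · obtain ⟨rfl, rfl⟩ := sCode_inj.1 (List.mem_singleton.1 h₂)
        rw [Bool.not_not] at hm; exact hm h₁
    · refine ⟨s, K, List.mem_singleton.1 h₁, fun h₂ => ?_⟩
      rcases List.mem_append.1 h₂ with h₂ | h₂
      · exact hm h₂
      · have := sCode_inj.1 (List.mem_singleton.1 h₂)
        simp at this

theorem Red.length_eq {r : List ℕ} (hr : Red r) : (r.length : ℤ) = ∑ K, |mult r K| := by
  have h₁ : ∀ K, |mult r K| = r.count (sCode false K) + r.count (sCode true K) := by
    intro K
    unfold mult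
    by_cases h : sCode false K ∈ r
    · obtain ⟨s, K', hs, h'⟩ := hr _ h
      obtain ⟨rfl, rfl⟩ := sCode_inj.1 hs
      rw [Bool.not_false] at h'
      rw [List.count_eq_zero_of_not_mem h']; simp
    · rw [List.count_eq_zero_of_not_mem h]; simp
  simp_rw [h₁]
  have h₂ : ∀ h ∈ r, ∃ s K, h = sCode s K := fun h hh => by
    obtain ⟨s, K, e, -⟩ := hr h hh
    exact ⟨s, K, e⟩
  clear h₁ hr
  induction r with
  | nil => simp
  | cons x t ih =>
    have := ih fun h hh => h₂ h (List.mem_cons_of_mem _ hh)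
    obtain ⟨s, K, rfl⟩ := h₂ x List.mem_cons_self
    simp only [List.count_cons, beq_iff_eq, sCode_inj, Nat.cast_add, List.length_cons]
    rw [this]
    simp only [Finset.sum_add_distrib]
    cases s <;> simp <;> ring

theorem Red.sg_mult_pos {r : List ℕ} (hr : Red r) {s : Bool} {K : Key} (h : sCode s K ∈ r) :
    0 < sg s * mult r K := by
  obtain ⟨s', K', hs, h'⟩ := hr _ h
  obtain ⟨rfl, rfl⟩ := sCode_inj.1 hs
  have h₁ := List.count_pos_iff.2 h
  have h₂ := List.count_eq_zero_of_not_mem h'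
  unfold mult
  cases s <;> simp_all [sg]

theorem lenLe_eq (r : List ℕ) (n : ℕ) : lenLe r n = decide (r.length ≤ n) := by
  induction r generalizing n with
  | nil => simp [lenLe]
  | cons x t ih =>
    cases n with
    | zero => simp [lenLe]
    | succ n =>
      have : lenLe (x :: t) (n + 1) = lenLe t n := rfl
      simp [this, ih]

theorem layer_eq (R : List (List ℕ)) (l : ℕ) : layer R l = R.getD l [] := by
  induction R generalizing l with
  | nil => simp [layer]
  | cons r R ih =>
    cases l with
    | zero => simp [layer]
    | succ l =>
      have : layer (r :: R) (l + 1) = layer R l := rfl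
      simp [this, ih]

theorem modK_true {h h' : ℕ} {R : List (List ℕ)} {j : ℕ} {k : List (List ℕ) → Bool}
    (H : modK h h' R j k = true) :
    ∃ R', k R' = true ∧ layer R' j = ins h h' (layer R j) ∧ ∀ l ≠ j, layer R' l = layer R l := by
  induction R generalizing j k with
  | nil => cases H
  | cons r R ih =>
    cases j with
    | zero =>
      refine ⟨ins h h' r :: R, ?_, rfl, fun l hl => ?_⟩
      · rw [← insK_eq h h' r fun r' => k (r' :: R)]; exact H
      · cases l with
        | zero => exact absurd rfl hl
        | succ l => rfl
    | succ j =>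
      obtain ⟨R', h₁, h₂, h₃⟩ := ih (j := j) (k := fun rest' => k (r :: rest')) H
      refine ⟨r :: R', h₁, h₂, fun l hl => ?_⟩
      cases l with
      | zero => rfl
      | succ l => exact h₃ l fun h => hl (by rw [h])

theorem decK_true {b : List ℕ} {j : ℕ} {k : List ℕ → Bool} (H : decK b j k = true)
    (hb : budget b j ≠ 0) :
    ∃ b', k b' = true ∧ budget b j = budget b' j + 1 ∧ ∀ i ≠ j, budget b' i = budget b i := by
  induction b generalizing j k with
  | nil => exact absurd rfl hb
  | cons m b ih =>
    cases j with
    | zero =>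
      cases m with
      | zero => exact absurd rfl hb
      | succ m =>
        refine ⟨m :: b, H, rfl, fun i hi => ?_⟩
        cases i with
        | zero => exact absurd rfl hi
        | succ i => rfl
    | succ j =>
      obtain ⟨b', h₁, h₂, h₃⟩ := ih (j := j) (k := fun b'' => k (m :: b'')) H hb
      refine ⟨m :: b', h₁, h₂, fun i hi => ?_⟩
      cases i with
      | zero => rfl
      | succ i => exact h₃ i fun h => hi (by rw [h])

theorem pickFirst_true {R : List (List ℕ)} {k : ℕ → ℕ → Bool} {kn : Bool} {i : ℕ}
    (H : pickFirst R k kn i = true) :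
    ((∀ l, layer R l = []) ∧ kn = true) ∨ ∃ l, ∃ h ∈ layer R l, k (i + l) h = true := by
  induction R generalizing i with
  | nil => exact .inl ⟨fun _ => rfl, H⟩
  | cons r R ih =>
    cases r with
    | nil =>
      rcases ih (i := i + 1) H with ⟨h₁, h₂⟩ | ⟨l, h, h₁, h₂⟩
      · refine .inl ⟨fun l => ?_, h₂⟩
        cases l with
        | zero => rfl
        | succ l => exact h₁ l
      · exact .inr ⟨l + 1, h, h₁, by rwa [add_comm l, ← add_assoc]⟩
    | cons h t => exact .inr ⟨0, h, List.mem_cons_self, H⟩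

theorem pickLast_true {R : List (List ℕ)} {k : ℕ → ℕ → Bool} {kn : Bool} {i : ℕ}
    (H : pickLast R k kn i = true) :
    ((∀ l, layer R l = []) ∧ kn = true) ∨ ∃ l, ∃ h ∈ layer R l, k (i + l) h = true := by
  induction R generalizing i kn with
  | nil => exact .inl ⟨fun _ => rfl, H⟩
  | cons r R ih =>
    rcases ih (i := i + 1) H with ⟨h₁, h₂⟩ | ⟨l, h, h₁, h₂⟩
    · cases r with
      | nil =>
        refine .inl ⟨fun l => ?_, h₂⟩
        cases l with
        | zero => rfl
        | succ l => exact h₁ l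
      | cons h t => exact .inr ⟨0, h, List.mem_cons_self, h₂⟩
    · exact .inr ⟨l + 1, h, h₁, by rwa [add_comm l, ← add_assoc]⟩

theorem allLt_true {f : ℕ → Bool} (H : allLt f = true) (x : Fin 6) : f x = true := by
  simp only [allLt, Bool.and_eq_true] at H
  fin_cases x <;> simp_all

@[simp] theorem opA_val (a b : Fin 6) : opA a b = (octAct a b : Fin 6) := by
  revert a b; decide +kernel

theorem opI_octAct (a b : Fin 6) : opI (octAct a b : Fin 6) b = a := by
  revert a b; decide +kernel

theorem ind_nonneg (u a b : Fin 6) (K : Key) : 0 ≤ ind u a b K := by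
  unfold ind; split_ifs <;> simp

theorem sum_ind_le (u a b : Fin 6) : ∑ K, ind u a b K ≤ 1 := by
  by_cases h : a = b <;> simp [ind, h]

theorem ind_pos {u a b : Fin 6} {K : Key} (h : 0 < ind u a b K) : K = (u, a, b) := by
  unfold ind at h
  split_ifs at h with h'
  · exact h'.2.symm
  · simp at h

theorem sum_abs_coef_le (x : STerm) (e : ℤ) :
    ∑ K, |coef x e K| ≤ 3 * ((if x.d = e then 1 else 0) + if x.d = e - 1 then 1 else 0) := by
  have aux : ∀ {I₁ I₂ I₃ : Key → ℤ}, (∀ K, 0 ≤ I₁ K) → (∀ K, 0 ≤ I₂ K) → (∀ K, 0 ≤ I₃ K) →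
      ∑ K, I₁ K ≤ 1 → ∑ K, I₂ K ≤ 1 → ∑ K, I₃ K ≤ 1 →
      ∑ K, |I₁ K - I₂ K + I₃ K| ≤ 3 := by
    intro I₁ I₂ I₃ p₁ p₂ p₃ h₁ h₂ h₃
    calc ∑ K, |I₁ K - I₂ K + I₃ K| ≤ ∑ K, (I₁ K + I₂ K + I₃ K) :=
          Finset.sum_le_sum fun K _ => abs_le.2 ⟨by linarith [p₁ K, p₂ K, p₃ K],
            by linarith [p₁ K, p₂ K, p₃ K]⟩
      _ ≤ 3 := by simp only [Finset.sum_add_distrib]; linarith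
  have habs : |sg x.s| = 1 := by cases x.s <;> simp [sg]
  simp only [coef, abs_mul, habs, one_mul]
  by_cases h : x.d = e
  · have h' : ¬ x.d = e - 1 := by omega
    simp only [if_pos h, if_neg h']
    have : ∀ K, |fCoef x K| = |ind x.u x.b x.c K - ind x.u x.a x.c K + ind x.u x.a x.b K| := by
      intro K
      rw [← abs_neg]
      congr 1
      simp only [fCoef]; ring
    simp_rw [this]
    exact aux (ind_nonneg _ _ _) (ind_nonneg _ _ _) (ind_nonneg _ _ _)
      (sum_ind_le _ _ _) (sum_ind_le _ _ _) (sum_ind_le _ _ _)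
  · by_cases h' : x.d + 1 = e
    · have h'' : x.d = e - 1 := by omega
      simp only [h, h', if_true, if_false]
      rw [if_pos h'']
      exact aux (ind_nonneg _ _ _) (ind_nonneg _ _ _) (ind_nonneg _ _ _)
        (sum_ind_le _ _ _) (sum_ind_le _ _ _) (sum_ind_le _ _ _)
    · have h'' : ¬ x.d = e - 1 := by omega
      simp [h, h', h'']

theorem num_cons (x : STerm) (L : Multiset STerm) (d : ℤ) :
    num (x ::ₘ L) d = num L d + if x.d = d then 1 else 0 := by
  simp [num, Multiset.countP_cons]

theorem sum_abs_cf_le (L : Multiset STerm) (e : ℤ) :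
    ∑ K, |cf L e K| ≤ 3 * ((num L e : ℤ) + num L (e - 1)) := by
  induction L using Multiset.induction_on with
  | empty => simp [num]
  | cons x L ih =>
    calc ∑ K, |cf (x ::ₘ L) e K| ≤ ∑ K, (|coef x e K| + |cf L e K|) :=
          Finset.sum_le_sum fun K _ => by rw [cf_cons]; exact abs_add_le _ _
      _ ≤ _ := by
        rw [Finset.sum_add_distrib]
        have := sum_abs_coef_le x e
        simp only [num_cons]
        push_cast
        linarith

theorem exists_coef_pos {L : Multiset STerm} {e : ℤ} {K : Key} {s : Bool}
    (h : 0 < sg s * cf L e K) : ∃ x ∈ L, 0 < sg s * coef x e K := by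
  induction L using Multiset.induction_on with
  | empty => simp at h
  | cons x L ih =>
    by_cases hx : 0 < sg s * coef x e K
    · exact ⟨x, Multiset.mem_cons_self _ _, hx⟩
    · rw [cf_cons, mul_add] at h
      obtain ⟨y, hy, h'⟩ := ih (by linarith)
      exact ⟨y, Multiset.mem_cons_of_mem hy, h'⟩

theorem strict_succ (n : ℕ) (f : ℕ → Bool) : strict (Nat.succ n) f = f n := rfl

theorem addKey_true {s : Bool} {l : ℕ} {u a b : Fin 6} {R : List (List ℕ)}
    {k : List (List ℕ) → Bool} (H : addKey s.toNat l u a b R k = true)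
    (hR : ∀ l, Red (layer R l)) :
    ∃ R', k R' = true ∧ (∀ l, Red (layer R' l)) ∧ ∀ l' K, mult (layer R' l') K =
      mult (layer R l') K + if l' = l then sg s * ind u a b K else 0 := by
  unfold addKey at H
  by_cases hab : a = b
  · subst hab
    refine ⟨R, ?_, hR, fun l' K => by simp [ind]⟩
    rwa [show Nat.beq (a : ℕ) a = true from Nat.beq_refl _] at H
  · rw [show Nat.beq (a : ℕ) b = false by
      rw [← Bool.not_eq_true, Nat.beq_eq, ← Fin.ext_iff]; exact hab] at H
    simp only [cond_false, strict_succ] at H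
    have h₁ : Nat.add (Nat.mul 216 s.toNat) (keyN u a b) = sCode s (u, a, b) := rfl
    have h₂ : Nat.add (Nat.mul 216 (Nat.sub 1 s.toNat)) (keyN u a b) =
        sCode (!s) (u, a, b) := by cases s <;> rfl
    rw [h₁, h₂] at H
    obtain ⟨R', hk, hl, hl'⟩ := modK_true H
    refine ⟨R', hk, fun l' => ?_, fun l' K => ?_⟩
    · by_cases h : l' = l
      · rw [h, hl]; exact (hR l).ins _ _
      · rw [hl' _ h]; exact hR l'
    · by_cases h : l' = l
      · rw [h, hl, mult_ins]; simp [ind, hab]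
      · rw [hl' _ h]; simp [h]

theorem toNat_not (s : Bool) : Nat.sub 1 s.toNat = (!s).toNat := by cases s <;> rfl

theorem sg_not (s : Bool) : sg (!s) = -sg s := by cases s <;> rfl

theorem addF_true {x : STerm} {j : ℕ} {R : List (List ℕ)} {k : List (List ℕ) → Bool}
    (H : addF j x.s.toNat (!x.s).toNat x.u x.a x.b x.c R k = true) (hR : ∀ l, Red (layer R l)) :
    ∃ R', k R' = true ∧ (∀ l, Red (layer R' l)) ∧ ∀ l K, mult (layer R' l) K =
      mult (layer R l) K - if l = j then sg x.s * fCoef x K else 0 := by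
  obtain ⟨R₁, H, hR, h₁⟩ := addKey_true H hR
  obtain ⟨R₂, H, hR, h₂⟩ := addKey_true H hR
  obtain ⟨R₃, H, hR, h₃⟩ := addKey_true H hR
  refine ⟨R₃, H, hR, fun l K => ?_⟩
  rw [h₃, h₂, h₁, sg_not, fCoef]
  split_ifs <;> ring

theorem addG_true {x : STerm} {j : ℕ} {R : List (List ℕ)} {k : List (List ℕ) → Bool}
    (H : addG j x.s.toNat (!x.s).toNat x.u x.a x.b x.c R k = true) (hR : ∀ l, Red (layer R l)) :
    ∃ R', k R' = true ∧ (∀ l, Red (layer R' l)) ∧ ∀ l K, mult (layer R' l) K =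
      mult (layer R l) K - if l = j then sg x.s * gCoef x K else 0 := by
  unfold addG at H
  simp only [opA_val] at H
  obtain ⟨R₁, H, hR, h₁⟩ := addKey_true H hR
  obtain ⟨R₂, H, hR, h₂⟩ := addKey_true H hR
  obtain ⟨R₃, H, hR, h₃⟩ := addKey_true H hR
  refine ⟨R₃, H, hR, fun l K => ?_⟩
  rw [h₃, h₂, h₁, sg_not, gCoef]
  split_ifs <;> ring

theorem addTerm_true {x : STerm} {n : ℤ} {lo hi j : ℕ} {R : List (List ℕ)} {bud : List ℕ}
    {k : List (List ℕ) → Bool}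
    (H : addTerm lo hi j x.s.toNat x.u x.a x.b x.c R bud k = true) (hd : x.d = n + j)
    (hlo : lo ≤ j + 1) (hj : j ≤ hi) (hR : ∀ l, Red (layer R l))
    (hfit : ∀ R' l, lo ≤ l → l ≤ hi → (∀ l, Red (layer R' l)) →
      (∀ K, mult (layer R' l) K = mult (layer R l) K - coef x (n + l) K) →
      fitAt R' bud l = true) :
    ∃ R', k R' = true ∧ (∀ l, Red (layer R' l)) ∧ ∀ l, lo ≤ l → l ≤ hi → ∀ K,
      mult (layer R' l) K = mult (layer R l) K - coef x (n + l) K := by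
  have hcoef : ∀ (l : ℕ) K, coef x (n + l) K =
      (if l = j then sg x.s * fCoef x K else 0) + if l = j + 1 then sg x.s * gCoef x K else 0 := by
    intro l K
    unfold coef
    rw [hd]
    by_cases h₁ : l = j
    · simp [h₁]
    · by_cases h₂ : l = j + 1
      · simp [h₂, add_assoc]
      · have h₃ : ¬ n + (j : ℤ) = n + l := by omega
        have h₄ : ¬ n + (j : ℤ) + 1 = n + l := by omega
        simp [h₁, h₂, h₃, h₄]
  have hG : ∀ R₁ : List (List ℕ), (∀ l, Red (layer R₁ l)) →
      (∀ l, lo ≤ l → ∀ K, mult (layer R₁ l) K =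
        mult (layer R l) K - if l = j then sg x.s * fCoef x K else 0) →
      cond (Nat.ble (j + 1) hi) (addG (j + 1) x.s.toNat (!x.s).toNat x.u x.a x.b x.c R₁
        fun R => cond (fitAt R bud (j + 1)) (k R) true) (k R₁) = true →
      ∃ R', k R' = true ∧ (∀ l, Red (layer R' l)) ∧ ∀ l, lo ≤ l → l ≤ hi → ∀ K,
        mult (layer R' l) K = mult (layer R l) K - coef x (n + l) K := by
    intro R₁ hR₁ hm₁ H
    by_cases h : j + 1 ≤ hi
    · rw [Nat.ble_eq_true_of_le h, cond_true] at H
      obtain ⟨R₂, H, hR₂, hm₂⟩ := addG_true H hR₁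
      have hm : ∀ l, lo ≤ l → ∀ K,
          mult (layer R₂ l) K = mult (layer R l) K - coef x (n + l) K := by
        intro l hl K
        rw [hm₂, hm₁ l hl, hcoef]; ring
      rw [hfit R₂ (j + 1) hlo h hR₂ (hm _ hlo)] at H
      exact ⟨R₂, H, hR₂, fun l hl _ => hm l hl⟩
    · rw [show Nat.ble (j + 1) hi = false by
        rw [← Bool.not_eq_true, Nat.ble_eq]; exact h] at H
      refine ⟨R₁, H, hR₁, fun l hl hl' K => ?_⟩
      rw [hm₁ l hl, hcoef, if_neg (show ¬ l = j + 1 by omega)]; ring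
  unfold addTerm at H
  simp only [strict_succ, toNat_not] at H
  by_cases hlo : lo ≤ j
  · rw [Nat.ble_eq_true_of_le hlo, cond_true] at H
    obtain ⟨R₁, H, hR₁, hm₁⟩ := addF_true H hR
    rw [hfit R₁ j hlo hj hR₁ fun K => by rw [hm₁, hcoef]; simp] at H
    exact hG R₁ hR₁ (fun l _ => hm₁ l) H
  · rw [show Nat.ble lo j = false by rw [← Bool.not_eq_true, Nat.ble_eq]; exact hlo] at H
    refine hG R hR (fun l hl K => ?_) H
    rw [if_neg (show ¬ l = j by omega)]; ring

theorem fitAt_of_le {R : List (List ℕ)} {bud : List ℕ} {l m : ℕ}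
    (hl : (layer R l).length ≤ 3 * (budget bud l + m))
    (hm : m ≤ match l with | 0 => 0 | l + 1 => budget bud l) : fitAt R bud l = true := by
  unfold fitAt
  rw [lenLe_eq, decide_eq_true_eq]
  refine hl.trans ?_
  cases l with
  | zero => exact Nat.mul_le_mul_left 3 (Nat.add_le_add_left hm _)
  | succ l => exact Nat.mul_le_mul_left 3 (Nat.add_le_add_left hm _)

/-- The search state `R`, `bud` describes the remaining terms `L`, where layer `l` corresponds to
degree `n + l`. -/
structure Describes (lo hi : ℕ) (n : ℤ) (R : List (List ℕ)) (bud : List ℕ)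
    (L : Multiset STerm) : Prop where
  red : ∀ l, Red (layer R l)
  valid : ∀ x ∈ L, x.Valid
  mult_eq : ∀ l, lo ≤ l → l ≤ hi → ∀ K, mult (layer R l) K = cf L (n + l) K
  le_d : ∀ x ∈ L, n + lo ≤ x.d + 1 → n ≤ x.d
  num_le : ∀ j, lo ≤ j + 1 → j ≤ hi → num L (n + j) ≤ budget bud j

theorem fitAt_of_num_le {lo hi : ℕ} {n : ℤ} {R : List (List ℕ)} {bud : List ℕ}
    {L : Multiset STerm} (h₀ : ∀ x ∈ L, n + lo ≤ x.d + 1 → n ≤ x.d)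
    (hb : ∀ j, lo ≤ j + 1 → j ≤ hi → num L (n + j) ≤ budget bud j)
    (hR : ∀ l, Red (layer R l)) {l : ℕ} (hl : lo ≤ l) (hl' : l ≤ hi)
    (hm : ∀ K, mult (layer R l) K = cf L (n + l) K) : fitAt R bud l = true := by
  have h₁ := (hR l).length_eq
  simp_rw [hm] at h₁
  have h₂ := h₁.trans_le (sum_abs_cf_le L (n + l))
  have h₃ := hb l (by omega) hl'
  refine fitAt_of_le (m := num L (n + l - 1)) (by omega) ?_
  cases l with
  | zero =>
    refine (Multiset.countP_eq_zero.2 fun x hx hd => ?_).le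
    have := h₀ x hx
    simp only [Nat.cast_zero] at hd
    omega
  | succ l =>
    have := hb l (by omega) (by omega)
    rw [show n + (l : ℤ) = n + ((l + 1 : ℕ) : ℤ) - 1 by push_cast; ring] at this
    exact this

/-- The code of a signed term. -/
def STerm.code (n : ℤ) (x : STerm) : Code :=
  ⟨(x.d - n).toNat, x.s.toNat, x.u, x.a, x.b, x.c⟩

theorem beq_val_false {a b : Fin 6} (h : a ≠ b) : Nat.beq (a : ℕ) b = false := by
  rw [← Bool.not_eq_true, Nat.beq_eq, ← Fin.ext_iff]; exact h

theorem Describes.addTerm {lo hi : ℕ} {n : ℤ} {R : List (List ℕ)} {bud bud' : List ℕ} {x : STerm}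
    {L : Multiset STerm} (h : Describes lo hi n R bud (x ::ₘ L)) {j : ℕ} (hd : x.d = n + j)
    (hj : lo ≤ j + 1) (hj' : j ≤ hi) (hb : budget bud j = budget bud' j + 1)
    (hb' : ∀ i ≠ j, budget bud' i = budget bud i) {k : List (List ℕ) → Bool}
    (H : addTerm lo hi j x.s.toNat x.u x.a x.b x.c R bud' k = true) :
    ∃ R', k R' = true ∧ Describes lo hi n R' bud' L := by
  have h₀ : ∀ y ∈ L, n + lo ≤ y.d + 1 → n ≤ y.d :=
    fun y hy => h.le_d y (Multiset.mem_cons_of_mem hy)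
  have hnum : ∀ i, lo ≤ i + 1 → i ≤ hi → num L (n + i) ≤ budget bud' i := by
    intro i hi₁ hi₂
    have := h.num_le i hi₁ hi₂
    rw [num_cons, hd] at this
    by_cases hij : i = j
    · subst hij; simp at this; omega
    · rw [hb' i hij]; omega
  have hcf : ∀ l, lo ≤ l → l ≤ hi → ∀ K,
      mult (layer R l) K - coef x (n + l) K = cf L (n + l) K := by
    intro l hl hl' K
    rw [h.mult_eq l hl hl', cf_cons]; ring
  obtain ⟨R', hk, hR', hm⟩ := addTerm_true H hd hj hj' h.red fun R' l hl hl' hR' hm =>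
    fitAt_of_num_le h₀ hnum hR' hl hl' fun K => (hm K).trans (hcf l hl hl' K)
  exact ⟨R', hk, hR', fun y hy => h.valid y (Multiset.mem_cons_of_mem hy),
    fun l hl hl' K => (hm l hl hl' K).trans (hcf l hl hl' K), h₀, hnum⟩

theorem Describes.extend {lo hi : ℕ} {n : ℤ} {R : List (List ℕ)} {bud bud' : List ℕ} {x : STerm}
    {L : Multiset STerm} (h : Describes lo hi n R bud (x ::ₘ L)) {j : ℕ} (hd : x.d = n + j)
    (hj : lo ≤ j + 1) (hj' : j ≤ hi) (hb : budget bud j = budget bud' j + 1)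
    (hb' : ∀ i ≠ j, budget bud' i = budget bud i)
    {next : List (List ℕ) → List ℕ → List Code → Bool} {cur : List Code}
    (H : extend lo hi next R cur j bud' x.s.toNat x.u x.a x.b x.c = true) :
    ∃ R', next R' bud' (x.code n :: cur) = true ∧ Describes lo hi n R' bud' L := by
  have hv := h.valid x (Multiset.mem_cons_self _ _)
  unfold Search.extend at H
  rw [beq_val_false hv.1, beq_val_false hv.2, cond_false, cond_false] at H
  obtain ⟨R', hk, hR'⟩ := h.addTerm hd hj hj' hb hb' H
  refine ⟨R', ?_, hR'⟩
  have : (x.d - n).toNat = j := by omega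
  simpa only [STerm.code, this] using hk

theorem Describes.budget_ne_zero {lo hi : ℕ} {n : ℤ} {R : List (List ℕ)} {bud : List ℕ}
    {x : STerm} {L : Multiset STerm} (h : Describes lo hi n R bud (x ::ₘ L)) {j : ℕ}
    (hd : x.d = n + j) (hj : lo ≤ j + 1) (hj' : j ≤ hi) : budget bud j ≠ 0 := by
  have := h.num_le j hj hj'
  rw [num_cons, if_pos hd] at this
  omega

theorem sCode_div (s : Bool) (K : Key) : Nat.div (sCode s K) 216 = s.toNat := by
  have := K.code_lt
  change sCode s K / 216 = _
  unfold sCode; omega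

theorem sCode_fst (s : Bool) (K : Key) : Nat.mod (Nat.div (sCode s K) 36) 6 = K.1 := by
  change sCode s K / 36 % 6 = _
  simp only [sCode, Key.code, keyN_eq]; omega

theorem sCode_snd_fst (s : Bool) (K : Key) : Nat.mod (Nat.div (sCode s K) 6) 6 = K.2.1 := by
  change sCode s K / 6 % 6 = _
  simp only [sCode, Key.code, keyN_eq]; omega

theorem sCode_snd_snd (s : Bool) (K : Key) : Nat.mod (sCode s K) 6 = K.2.2 := by
  change sCode s K % 6 = _
  simp only [sCode, Key.code, keyN_eq]; omega

theorem fCoef_pos {x : STerm} {s : Bool} {K : Key} (h : 0 < sg s * (sg x.s * fCoef x K)) :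
    (x.s = (!s) ∧ K = (x.u, x.b, x.c)) ∨ (x.s = s ∧ K = (x.u, x.a, x.c)) ∨
      (x.s = (!s) ∧ K = (x.u, x.a, x.b)) := by
  have h₁ := ind_nonneg x.u x.b x.c K
  have h₂ := ind_nonneg x.u x.a x.c K
  have h₃ := ind_nonneg x.u x.a x.b K
  by_cases hs : x.s = s
  · have : sg s * (sg x.s * fCoef x K) = fCoef x K := by
      rw [hs]; cases s <;> simp [sg]
    rw [this, fCoef] at h
    exact .inr (.inl ⟨hs, ind_pos (by linarith)⟩)
  · have hs : x.s = !s := by cases h : x.s <;> cases s <;> simp_all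
    have : sg s * (sg x.s * fCoef x K) = -fCoef x K := by
      rw [hs]; cases s <;> simp [sg]
    rw [this, fCoef] at h
    by_cases h' : 0 < ind x.u x.b x.c K
    · exact .inl ⟨hs, ind_pos h'⟩
    · exact .inr (.inr ⟨hs, ind_pos (by linarith)⟩)

theorem gCoef_pos {x : STerm} {s : Bool} {K : Key} (h : 0 < sg s * (sg x.s * gCoef x K)) :
    (x.s = s ∧ K = (octAct x.u x.a, x.b, x.c)) ∨
      (x.s = (!s) ∧ K = (octAct x.u x.b, octAct x.a x.b, x.c)) ∨
      (x.s = s ∧ K = (octAct x.u x.c, octAct x.a x.c, octAct x.b x.c)) := by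
  have h₁ := ind_nonneg (octAct x.u x.a) x.b x.c K
  have h₂ := ind_nonneg (octAct x.u x.b) (octAct x.a x.b) x.c K
  have h₃ := ind_nonneg (octAct x.u x.c) (octAct x.a x.c) (octAct x.b x.c) K
  by_cases hs : x.s = s
  · have : sg s * (sg x.s * gCoef x K) = gCoef x K := by
      rw [hs]; cases s <;> simp [sg]
    rw [this, gCoef] at h
    by_cases h' : 0 < ind (octAct x.u x.a) x.b x.c K
    · exact .inl ⟨hs, ind_pos h'⟩
    · exact .inr (.inr ⟨hs, ind_pos (by linarith)⟩)
  · have hs : x.s = !s := by cases h : x.s <;> cases s <;> simp_all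
    have : sg s * (sg x.s * gCoef x K) = -gCoef x K := by
      rw [hs]; cases s <;> simp [sg]
    rw [this, gCoef] at h
    exact .inr (.inl ⟨hs, ind_pos (by linarith)⟩)

theorem Describes.branch {lo hi : ℕ} {n : ℤ} {R : List (List ℕ)} {bud : List ℕ}
    {L : Multiset STerm} (h : Describes lo hi n R bud L)
    {next : List (List ℕ) → List ℕ → List Code → Bool} {cur : List Code} {l m : ℕ}
    (hm : m ∈ layer R l) (H : branch lo hi next R bud cur l m = true) :
    ∃ x L' R' bud', L = x ::ₘ L' ∧ n ≤ x.d ∧ next R' bud' (x.code n :: cur) = true ∧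
      Describes lo hi n R' bud' L' := by
  obtain ⟨s, K, rfl, -⟩ := h.red l m hm
  unfold Search.branch at H
  simp only [strict_succ, sCode_div, sCode_fst, sCode_snd_fst,
    sCode_snd_snd, toNat_not, Bool.and_eq_true, Nat.ble_eq] at H
  obtain ⟨⟨hlo, hhi⟩, HF, HG⟩ := H
  have hcf := (h.red l).sg_mult_pos hm
  rw [h.mult_eq l hlo hhi] at hcf
  obtain ⟨x, hx, hpos⟩ := exists_coef_pos hcf
  obtain ⟨L', rfl⟩ := Multiset.exists_cons_of_mem hx
  have key : ∀ j : ℕ, x.d = n + j → lo ≤ j + 1 → j ≤ hi → ∀ bud' : List ℕ,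
      budget bud j = budget bud' j + 1 → (∀ i ≠ j, budget bud' i = budget bud i) →
      Search.extend lo hi next R cur j bud' x.s.toNat x.u x.a x.b x.c = true →
      ∃ y L'' R' bud', x ::ₘ L' = y ::ₘ L'' ∧ n ≤ y.d ∧ next R' bud' (y.code n :: cur) = true ∧
        Describes lo hi n R' bud' L'' := by
    intro j hd hj hj' bud' hb hb' H
    obtain ⟨R', hk, hD⟩ := h.extend hd hj hj' hb hb' H
    exact ⟨x, L', R', bud', rfl, by omega, hk, hD⟩
  unfold coef at hpos
  by_cases hd : x.d = n + l
  · rw [if_pos hd] at hpos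
    obtain ⟨bud', HF, hb, hb'⟩ := decK_true HF (h.budget_ne_zero hd (by omega) hhi)
    refine key l hd (by omega) hhi bud' hb hb' ?_
    rcases fCoef_pos hpos with ⟨hs, rfl⟩ | ⟨hs, rfl⟩ | ⟨hs, rfl⟩
    · have := allLt_true HF x.a
      simp only [Bool.and_eq_true] at this
      rw [hs]; exact this.1
    · have := allLt_true HF x.b
      simp only [Bool.and_eq_true] at this
      rw [hs]; exact this.2.1
    · have := allLt_true HF x.c
      simp only [Bool.and_eq_true] at this
      rw [hs]; exact this.2.2
  · rw [if_neg hd] at hpos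
    by_cases hd' : x.d + 1 = n + l
    · rw [if_pos hd'] at hpos
      have hn := h.le_d x hx (by omega)
      cases l with
      | zero => simp at hd'; omega
      | succ j =>
        have hdj : x.d = n + j := by push_cast at hd'; omega
        obtain ⟨bud', HG, hb, hb'⟩ := decK_true HG (h.budget_ne_zero hdj hlo (by omega))
        refine key j hdj hlo (by omega) bud' hb hb' ?_
        rcases gCoef_pos hpos with ⟨hs, rfl⟩ | ⟨hs, rfl⟩ | ⟨hs, rfl⟩
        · have := allLt_true HG x.a
          simp only [Bool.and_eq_true, opI_octAct] at this
          rw [hs]; exact this.1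
        · have := allLt_true HG x.b
          simp only [Bool.and_eq_true, opI_octAct] at this
          rw [hs]; exact this.2.1
        · have := allLt_true HG x.c
          simp only [Bool.and_eq_true, opI_octAct] at this
          rw [hs]; exact this.2.2
    · rw [if_neg hd'] at hpos
      simp at hpos

/-- The `η`-weight of the image of a signed term under the rotation given by `w`. -/
def etaT (w : List ℕ) (x : STerm) : ZMod 3 :=
  (sg x.s : ZMod 3) * (etaN (rotN w x.a) (rotN w x.b) (rotN w x.c) : ZMod 3)

def etaM (w : List ℕ) (L : Multiset STerm) : ZMod 3 := (L.map (etaT w)).sum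

theorem etaSum_cast (n : ℤ) (w : List ℕ) (cur : List STerm) :
    (etaSum w (cur.map (STerm.code n)) : ZMod 3) = etaM w cur := by
  induction cur with
  | nil => simp [etaSum, etaM]
  | cons x t ih =>
    have : etaSum w ((x :: t).map (STerm.code n)) =
      (x.s.toNat + 1) * etaN (rotN w x.a) (rotN w x.b) (rotN w x.c) +
        etaSum w (t.map (STerm.code n)) := rfl
    rw [this]
    have hs : ((x.s.toNat : ZMod 3) + 1) = (sg x.s : ℤ) := by cases x.s <;> decide
    simp only [etaM, Multiset.map_coe, List.map_cons, Multiset.sum_coe, List.sum_cons] at ih ⊢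
    push_cast
    rw [ih, hs, etaT]

/-- `L` contains a nonzero subcycle all of whose rotations have weight zero. -/
def HasNullSub (L : Multiset STerm) : Prop :=
  ∃ C ≤ L, C ≠ 0 ∧ IsCyc C ∧ ∀ w ∈ words, etaM w C = 0

theorem coef_eq_zero {x : STerm} {e : ℤ} (h : x.d ≠ e) (h' : x.d + 1 ≠ e) (K : Key) :
    coef x e K = 0 := by simp [coef, h, h']

theorem cf_eq_zero {L : Multiset STerm} {e : ℤ} (h : ∀ x ∈ L, x.d ≠ e ∧ x.d + 1 ≠ e) (K : Key) :
    cf L e K = 0 :=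
  Multiset.sum_eq_zero fun y hy => by
    obtain ⟨x, hx, rfl⟩ := Multiset.mem_map.1 hy
    exact coef_eq_zero (h x hx).1 (h x hx).2 K

theorem leafOk_sound {lo hi : ℕ} {n : ℤ} {R : List (List ℕ)} {bud : List ℕ} {cur : List STerm}
    {L : Multiset STerm} (h : Describes lo hi n R bud L)
    (H : leafOk lo hi (cur.map (STerm.code n)) = true) (hR : ∀ l, layer R l = [])
    (hcur : ∀ x ∈ cur, n ≤ x.d) (hne : cur ≠ [])
    (hc : ∀ l : ℕ, lo ≤ l → l ≤ hi → ∀ K, cf (cur + L) (n + l) K = 0) : HasNullSub (cur + L) := by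
  simp only [leafOk, Bool.and_eq_true, List.all_eq_true, Nat.ble_eq, List.mem_map] at H
  obtain ⟨hd, hw⟩ := H
  refine ⟨cur, Multiset.le_add_right _ _, by simpa using hne, fun e K => ?_, fun w hw' => ?_⟩
  · by_cases he : ∃ l : ℕ, lo ≤ l ∧ l ≤ hi ∧ e = n + l
    · obtain ⟨l, hl, hl', rfl⟩ := he
      have h₁ := h.mult_eq l hl hl' K
      have h₂ := hc l hl hl' K
      rw [cf_add] at h₂
      simp only [hR, mult, List.count_nil, sub_self] at h₁
      linarith
    · refine cf_eq_zero (fun x hx => ?_) K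
      have h₁ := hcur x (by simpa using hx)
      have h₂ := hd (x.code n) ⟨x, by simpa using hx, rfl⟩
      simp only [STerm.code] at h₂
      constructor
      · rintro rfl
        exact he ⟨(x.d - n).toNat, by omega, by omega, by omega⟩
      · rintro rfl
        exact he ⟨(x.d - n).toNat + 1, by omega, by omega, by push_cast; omega⟩
  · rw [← etaSum_cast n, ZMod.natCast_eq_zero_iff]
    exact Nat.dvd_of_mod_eq_zero (Nat.eq_of_beq_eq_true (hw w hw'))

theorem dfs_sound {last : Bool} {lo hi fuel : ℕ} {n : ℤ} {R : List (List ℕ)} {bud : List ℕ}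
    {cur : List STerm} {L : Multiset STerm} (h : Describes lo hi n R bud L)
    (H : dfs last lo hi fuel R bud (cur.map (STerm.code n)) = true)
    (hcur : ∀ x ∈ cur, n ≤ x.d) (hne : cur ≠ [])
    (hc : ∀ l : ℕ, lo ≤ l → l ≤ hi → ∀ K, cf (cur + L) (n + l) K = 0) : HasNullSub (cur + L) := by
  induction fuel generalizing R bud cur L with
  | zero => exact absurd H Bool.false_ne_true
  | succ fuel ih =>
    have H' : ((∀ l, layer R l = []) ∧ leafOk lo hi (cur.map (STerm.code n)) = true) ∨
        ∃ l, ∃ m ∈ layer R l, branch lo hi (dfs last lo hi fuel) R bud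
          (cur.map (STerm.code n)) (0 + l) m = true := by
      cases last
      · exact pickFirst_true H
      · exact pickLast_true H
    rcases H' with ⟨hR, hk⟩ | ⟨l, m, hm, hk⟩
    · exact leafOk_sound h hk hR hcur hne hc
    · rw [zero_add] at hk
      obtain ⟨x, L', R', bud', rfl, hd, hk, h'⟩ := h.branch hm hk
      have heq : (↑(x :: cur) : Multiset STerm) + L' = cur + x ::ₘ L' := by
        rw [← Multiset.cons_coe, Multiset.cons_add, Multiset.add_cons]
      have := ih (cur := x :: cur) h' hk (by simpa using ⟨hd, hcur⟩) (by simp) (by rwa [heq])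
      rwa [heq] at this

/-- The rotation given by a word. -/
def rot (w : List ℕ) (a : Fin 6) : Fin 6 := Fin.ofNat 6 (rotN w a)

theorem rot_val {w : List ℕ} (hw : w ∈ words) (a : Fin 6) : (rot w a : ℕ) = rotN w a := by
  revert w; revert a; decide +kernel

theorem rot_octAct {w : List ℕ} (hw : w ∈ words) (a b : Fin 6) :
    rot w (octAct a b) = octAct (rot w a) (rot w b) := by
  revert w; revert a b; decide +kernel

theorem exists_rot_inverse {w : List ℕ} (hw : w ∈ words) :
    ∃ w' ∈ words, (∀ a, rot w' (rot w a) = a) ∧ ∀ a, rot w (rot w' a) = a := by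
  revert w; decide +kernel

theorem exists_rot_start (u a b c : Fin 6) (hab : a ≠ b) (hbc : b ≠ c) :
    ∃ w ∈ words, rot w u = 0 ∧
      ((rot w a : ℕ), (rot w b : ℕ), (rot w c : ℕ)) ∈ starts := by
  revert u a b c; decide +kernel

theorem rot_injective {w : List ℕ} (hw : w ∈ words) : Function.Injective (rot w) := by
  obtain ⟨w', -, h, -⟩ := exists_rot_inverse hw
  exact Function.LeftInverse.injective h

/-- Apply a rotation, and change the sign if `t` is `true`. -/
def STerm.rot (w : List ℕ) (t : Bool) (x : STerm) : STerm :=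
  ⟨x.d, xor t x.s, Search.rot w x.u, Search.rot w x.a, Search.rot w x.b, Search.rot w x.c⟩

def Key.rot (w : List ℕ) (K : Key) : Key := (Search.rot w K.1, Search.rot w K.2.1, Search.rot w K.2.2)

theorem sg_xor (t s : Bool) : sg (xor t s) = sg t * sg s := by cases t <;> cases s <;> rfl

theorem ind_rot {w : List ℕ} (hw : w ∈ words) (u a b : Fin 6) (K : Key) :
    ind (rot w u) (rot w a) (rot w b) (K.rot w) = ind u a b K := by
  obtain ⟨u', a', b'⟩ := K
  simp only [ind, Key.rot, Prod.mk.injEq, (rot_injective hw).eq_iff, ne_eq]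

theorem coef_rot {w : List ℕ} (hw : w ∈ words) (t : Bool) (x : STerm) (e : ℤ) (K : Key) :
    coef (x.rot w t) e (K.rot w) = sg t * coef x e K := by
  simp only [coef, STerm.rot, fCoef, gCoef, ← rot_octAct hw, ind_rot hw, sg_xor, mul_assoc]

theorem cf_map_rot {w : List ℕ} (hw : w ∈ words) (t : Bool) (L : Multiset STerm) (e : ℤ)
    (K : Key) : cf (L.map (STerm.rot w t)) e (K.rot w) = sg t * cf L e K := by
  simp only [cf, Multiset.map_map, Function.comp_def, coef_rot hw, Multiset.sum_map_mul_left]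

theorem cf_map_rot_eq_zero {w : List ℕ} (hw : w ∈ words) (t : Bool) {L : Multiset STerm} {e : ℤ}
    (h : ∀ K, cf L e K = 0) (K : Key) : cf (L.map (STerm.rot w t)) e K = 0 := by
  obtain ⟨w', -, -, hr⟩ := exists_rot_inverse hw
  have : (K.rot w').rot w = K := by simp [Key.rot, hr]
  rw [← this, cf_map_rot hw, h, mul_zero]

theorem num_map_rot (w : List ℕ) (t : Bool) (L : Multiset STerm) (d : ℤ) :
    num (L.map (STerm.rot w t)) d = num L d := by
  rw [num, num, Multiset.countP_map, Multiset.countP_eq_card_filter]; rfl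

/-- The `η`-weight. -/
def eta (L : Multiset STerm) : ZMod 3 := etaM [] L

theorem eta_map_rot {w : List ℕ} (hw : w ∈ words) (t : Bool) (L : Multiset STerm) :
    eta (L.map (STerm.rot w t)) = (sg t : ZMod 3) * etaM w L := by
  simp only [eta, etaM, Multiset.map_map, Function.comp_def, ← Multiset.sum_map_mul_left]
  refine congrArg _ (Multiset.map_congr rfl fun x _ => ?_)
  simp only [etaT, STerm.rot, sg_xor, Int.cast_mul, ← rot_val hw, mul_assoc]
  rfl

theorem run_sound {last : Bool} {lo hi j : ℕ} {bud : List ℕ} (H : run last lo hi j bud = true)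
    {n : ℤ} {L : Multiset STerm} (hL : ∀ x ∈ L, x.Valid)
    (hc : ∀ l : ℕ, lo ≤ l → l ≤ hi → ∀ K, cf L (n + l) K = 0)
    (h₀ : ∀ x ∈ L, n + lo ≤ x.d + 1 → n ≤ x.d)
    (hb : ∀ j, lo ≤ j + 1 → j ≤ hi → num L (n + j) ≤ budget bud j)
    (hj : lo ≤ j + 1) (hj' : j ≤ hi) (hx : num L (n + j) ≠ 0) :
    ∃ C ≤ L, C ≠ 0 ∧ IsCyc C ∧ eta C = 0 := by
  obtain ⟨x, hxL, hd⟩ := Multiset.countP_pos.1 (Nat.pos_of_ne_zero hx)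
  obtain ⟨w, hw, hu, hs⟩ := exists_rot_start x.u x.a x.b x.c (hL x hxL).1 (hL x hxL).2
  have hbj : budget bud j ≠ 0 := fun h => hx (Nat.le_zero.1 (h ▸ hb j hj hj'))
  obtain ⟨bud', H, hb₁, hb₂⟩ := decK_true (List.all_eq_true.1 H _ hs) hbj
  set φ := STerm.rot w x.s with hφ
  have hys : (φ x).s = false := Bool.xor_self _
  have hyu : (φ x).u = 0 := hu
  obtain ⟨L', rfl⟩ := Multiset.exists_cons_of_mem hxL
  have hc' := fun (l : ℕ) (h : lo ≤ l) (h' : l ≤ hi) =>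
    cf_map_rot_eq_zero hw x.s (hc l h h')
  have hnil : ∀ l, layer [[], [], [], []] l = [] := by
    intro l
    rw [layer_eq]
    rcases l with _ | _ | _ | _ | l <;> rfl
  have hD : Describes lo hi n [[], [], [], []] bud (φ x ::ₘ L'.map φ) := by
    rw [← Multiset.map_cons]
    refine ⟨fun l => ?_, ?_, fun l h h' K => ?_, ?_, fun i h h' => ?_⟩
    · rw [hnil]; simp [Red]
    · rw [Multiset.forall_mem_map_iff]
      exact fun z hz => ⟨(rot_injective hw).ne (hL z hz).1, (rot_injective hw).ne (hL z hz).2⟩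
    · rw [hc' l h h', hnil]; simp [mult]
    · rw [Multiset.forall_mem_map_iff]; exact h₀
    · rw [num_map_rot]; exact hb i h h'
  have H' : addTerm lo hi j (φ x).s.toNat (φ x).u (φ x).a (φ x).b (φ x).c [[], [], [], []] bud'
      (fun R => dfs last lo hi 8 R bud' ([φ x].map (STerm.code n))) = true := by
    have : (φ x).code n = ⟨j, 0, 0, (φ x).a, (φ x).b, (φ x).c⟩ := by
      have : ((φ x).d - n).toNat = j := by
        have : (φ x).d = x.d := rfl
        omega
      rw [STerm.code, this, hys, hyu]; rfl
    rw [List.map_singleton, this, hys, hyu]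
    exact H
  obtain ⟨R', hk, hR'⟩ := hD.addTerm (x := φ x) hd hj hj' hb₁ hb₂ H'
  obtain ⟨C, hC, hC₀, hcyc, heta⟩ := dfs_sound hR' hk
    (by rw [List.forall_mem_singleton]; change n ≤ x.d; omega) (by simp)
    (by simpa using hc')
  rw [Multiset.coe_singleton, Multiset.singleton_add, ← Multiset.map_cons] at hC
  obtain ⟨w', hw', hl, hr⟩ := exists_rot_inverse hw
  have hinv : ∀ z, STerm.rot w' x.s (φ z) = z := fun z => by
    simp [hφ, STerm.rot, hl]
  refine ⟨C.map (STerm.rot w' x.s), ?_, by simpa using hC₀,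
    fun e => cf_map_rot_eq_zero hw' _ (hcyc e), ?_⟩
  · refine (Multiset.map_le_map hC).trans_eq ?_
    simp [Multiset.map_map, hinv]
  · rw [eta_map_rot hw', heta w' hw', mul_zero]

theorem etaM_add (w : List ℕ) (L M : Multiset STerm) : etaM w (L + M) = etaM w L + etaM w M := by
  simp [etaM]

theorem eta_add (L M : Multiset STerm) : eta (L + M) = eta L + eta M := etaM_add _ _ _

theorem IsCyc.of_add {C D : Multiset STerm} (h : IsCyc (C + D)) (hC : IsCyc C) : IsCyc D := by
  intro e K
  have := h e K
  rw [cf_add, hC e K, zero_add] at this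
  exact this

theorem num_eq_zero {L : Multiset STerm} {d : ℤ} (h : ∀ x ∈ L, x.d ≠ d) : num L d = 0 :=
  Multiset.countP_eq_zero.2 h

theorem ne_of_num_eq_zero {L : Multiset STerm} {d : ℤ} (h : num L d = 0) {x : STerm}
    (hx : x ∈ L) : x.d ≠ d :=
  Multiset.countP_eq_zero.1 h x hx

theorem num_ne_zero {L : Multiset STerm} {x : STerm} (hx : x ∈ L) : num L x.d ≠ 0 :=
  fun h => ne_of_num_eq_zero h hx rfl

theorem card_eq_sum_num {L : Multiset STerm} {n : ℤ} {M : ℕ}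
    (h : ∀ x ∈ L, n ≤ x.d ∧ x.d ≤ n + M) :
    L.card = ∑ l ∈ Finset.range (M + 1), num L (n + l) := by
  induction L using Multiset.induction_on with
  | empty => simp [num]
  | cons x L ih =>
    rw [Multiset.card_cons, ih fun y hy => h y (Multiset.mem_cons_of_mem hy)]
    simp only [num_cons, Finset.sum_add_distrib]
    have hx := h x (Multiset.mem_cons_self _ _)
    rw [Finset.sum_eq_single (a := (x.d - n).toNat)
      (f := fun l : ℕ => if x.d = n + (l : ℤ) then 1 else 0), if_pos (by omega)]
    · intro l _ hl
      rw [if_neg (by omega)]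
    · intro hl
      exact absurd (Finset.mem_range.2 (by omega)) hl

/-- The possible shapes, for a cycle with lowest degree `n`. -/
def HasShape (L : Multiset STerm) (n : ℤ) : Prop :=
  num L n ≠ 0 ∧ (∀ x ∈ L, n ≤ x.d) ∧ 6 ≤ L.card ∧ (num L n = L.card ∨
    num L n + num L (n + 1) = L.card ∧
      (num L n = 2 ∨ num L n = 3 ∨ num L (n + 1) = 2 ∨ num L (n + 1) = 3))

/-- A cycle without terms in an intermediate degree splits. -/
theorem IsCyc.filter_lt {L : Multiset STerm} (hc : IsCyc L) {d : ℤ} (hd : num L d = 0) :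
    IsCyc (L.filter fun x => x.d < d) := by
  intro e K
  have h := hc e K
  rw [← Multiset.filter_add_not (fun x => x.d < d) L, cf_add] at h
  by_cases he : e ≤ d
  · rwa [cf_eq_zero (L := L.filter fun x => ¬ x.d < d), add_zero] at h
    intro x hx
    obtain ⟨hx, hxd⟩ := Multiset.mem_filter.1 hx
    have := ne_of_num_eq_zero hd hx
    constructor <;> omega
  · refine cf_eq_zero (fun x hx => ?_) K
    have := (Multiset.mem_filter.1 hx).2
    constructor <;> omega

theorem shape_of_counts (c : ℕ → ℕ) {M : ℕ} (hM : M ≤ 6)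
    (hsum : ∑ l ∈ Finset.range (M + 1), c l ≤ 7) (hgap : ∀ l ≤ M, c l ≠ 0)
    (hz : ∀ l, M < l → c l = 0) (f₁ : c 0 ≠ 1) (f₂ : c M ≠ 1)
    (f₃ : c 0 ≤ 3 → ¬ c 1 ≤ 1) (f₄ : ∀ l, l + 1 = M → c M ≤ 3 → ¬ c l ≤ 1)
    (f₅ : M = 0 → ¬ c 0 ≤ 5) (f₆ : M ≤ 2 → c 0 ≤ 2 → c 1 ≤ 2 → ¬ c 2 ≤ 3)
    (f₇ : M ≤ 2 → c 0 ≤ 2 → c 1 ≤ 3 → ¬ c 2 ≤ 2) (f₈ : M = 2 → c 0 ≤ 3 → c 1 ≤ 2 → ¬ c 2 ≤ 2)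
    (f₉ : M = 1 → c 0 ≤ 3 → ¬ c 1 ≤ 2) :
    6 ≤ ∑ l ∈ Finset.range (M + 1), c l ∧ (c 0 = ∑ l ∈ Finset.range (M + 1), c l ∨
      c 0 + c 1 = ∑ l ∈ Finset.range (M + 1), c l ∧ (c 0 = 2 ∨ c 0 = 3 ∨ c 1 = 2 ∨ c 1 = 3)) := by
  have g₀ := hgap 0
  have g₁ := hgap 1
  have g₂ := hgap 2
  have g₃ := hgap 3
  have g₄ := hgap 4
  have g₅ := hgap 5
  have z₁ := hz 1
  have z₂ := hz 2
  clear hgap hz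
  interval_cases M <;> simp only [Finset.sum_range_succ, Finset.sum_range_zero] at *
  · have := f₅ trivial; omega
  · have := f₄ 0 rfl; have := f₉ trivial; omega
  · have := f₄ 1 rfl; have := f₈ trivial; omega
  · have := f₄ 2 rfl; omega
  · omega
  · omega
  · omega

theorem exists_null_or_split_or_shape {L : Multiset STerm} (hL : ∀ x ∈ L, x.Valid) (hc : IsCyc L)
    (hne : L ≠ 0) (hcard : L.card ≤ 7) :
    (∃ C ≤ L, C ≠ 0 ∧ IsCyc C ∧ eta C = 0) ∨ (∃ C ≤ L, C ≠ 0 ∧ C ≠ L ∧ IsCyc C) ∨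
      ∃ n, HasShape L n := by
  have hne' : L.toFinset.Nonempty := by
    obtain ⟨x, hx⟩ := Multiset.exists_mem_of_ne_zero hne
    exact ⟨x, Multiset.mem_toFinset.2 hx⟩
  obtain ⟨x, hx, hmin⟩ := L.toFinset.exists_min_image STerm.d hne'
  obtain ⟨y, hy, hmax⟩ := L.toFinset.exists_max_image STerm.d hne'
  simp only [Multiset.mem_toFinset] at hx hmin hy hmax
  obtain ⟨M, hM⟩ := Int.le.dest (hmin y hy)
  set n := x.d
  rw [← hM] at hmax
  have hn := num_ne_zero hx
  have hN : num L (n + M) ≠ 0 := hM ▸ num_ne_zero hy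
  by_cases hgap : ∃ l ≤ M, num L (n + l) = 0
  · obtain ⟨l, hl, hl'⟩ := hgap
    refine .inr (.inl ⟨_, Multiset.filter_le (fun z => z.d < n + l) L, fun h => ?_, fun h => ?_,
      hc.filter_lt hl'⟩)
    · have h₁ := Multiset.filter_eq_nil.1 h x hx
      have h₂ := ne_of_num_eq_zero hl' hx
      change ¬ n < n + l at h₁
      change n ≠ n + l at h₂
      omega
    · have := Multiset.filter_eq_self.1 h y hy
      omega
  push Not at hgap
  have hsum := card_eq_sum_num fun z hz => ⟨hmin z hz, hmax z hz⟩
  have hM6 : M ≤ 6 := by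
    have : ∑ l ∈ Finset.range (M + 1), 1 ≤ ∑ l ∈ Finset.range (M + 1), num L (n + l) :=
      Finset.sum_le_sum fun l hl =>
        Nat.one_le_iff_ne_zero.2 (hgap l (Nat.lt_succ_iff.1 (Finset.mem_range.1 hl)))
    simp at this
    omega
  have hzero : ∀ d, n + M < d → num L d = 0 := fun d hd => num_eq_zero fun z hz h => by
    have := hmax z hz
    omega
  have hcyc := fun (m : ℤ) (lo hi l : ℕ) (_ : lo ≤ l) (_ : l ≤ hi) K => hc (m + l) K
  by_cases hsub : ∃ C ≤ L, C ≠ 0 ∧ IsCyc C ∧ eta C = 0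
  · exact .inl hsub
  have f₁ : num L n ≠ 1 := fun h => hsub <|
    run_sound run_first_single hL (hcyc n _ _) (fun z hz _ => hmin z hz) (fun j _ hj => by
      interval_cases j; simp [h, budget]) (by simp) le_rfl (by simpa using hn)
  have f₂ : num L (n + M) ≠ 1 := fun h => hsub <|
    run_sound run_last_single hL (hcyc (n + M) _ _) (fun z hz _ => by push_cast at *; omega)
      (fun j _ hj => by
        interval_cases j
        · simp [h, budget]
        · rw [hzero]
          · simp
          · simp) (by simp) (by simp) (by simpa using hN)
  have f₃ : num L n ≤ 3 → ¬ num L (n + 1) ≤ 1 := fun h h' => hsub <|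
    run_sound run_first_pair hL (hcyc n _ _) (fun z hz _ => hmin z hz) (fun j _ hj => by
      interval_cases j
      · simpa [budget] using h
      · simpa [budget] using h') (by simp) (by simp) (by simpa using hn)
  have f₄ : num L (n + M) ≤ 3 → ¬ num L (n + M - 1) ≤ 1 := fun h h' => hsub <|
    run_sound run_last_pair hL (hcyc (n + M - 1) _ _) (fun z hz _ => by push_cast at *; omega)
      (fun j _ hj => by
        interval_cases j
        · simpa [budget] using h'
        · simpa [budget] using h
        · rw [hzero]
          · simp
          · push_cast; omega) (by simp) (by simp) (by simpa using hN)
  have f₅ : M = 0 → ¬ num L n ≤ 5 := fun hM0 h => hsub <|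
    run_sound run_single_degree hL (hcyc n _ _) (fun z hz _ => hmin z hz) (fun j _ hj => by
      interval_cases j
      · simpa [budget] using h
      · rw [hzero]
        · simp
        · simp [hM0]) (by simp) (by simp) (by simpa using hn)
  have f₆ : M ≤ 2 → num L n ≤ 2 → num L (n + 1) ≤ 2 → ¬ num L (n + 2) ≤ 3 :=
    fun hM2 h h' h'' => hsub <|
    run_sound run_two_two_three hL (hcyc n _ _) (fun z hz _ => hmin z hz) (fun j _ hj => by
      interval_cases j
      · simpa [budget] using h
      · simpa [budget] using h'
      · exact h''
      · rw [hzero]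
        · simp
        · push_cast; omega) (by simp) (by simp) (by simpa using hn)
  have f₇ : M ≤ 2 → num L n ≤ 2 → num L (n + 1) ≤ 3 → ¬ num L (n + 2) ≤ 2 :=
    fun hM2 h h' h'' => hsub <|
    run_sound run_two_three_two hL (hcyc n _ _) (fun z hz _ => hmin z hz) (fun j _ hj => by
      interval_cases j
      · simpa [budget] using h
      · simpa [budget] using h'
      · exact h''
      · rw [hzero]
        · simp
        · push_cast; omega) (by simp) (by simp) (by simpa using hn)
  have f₈ : M = 2 → num L n ≤ 3 → num L (n + 1) ≤ 2 → ¬ num L (n + 2) ≤ 2 :=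
    fun hM2 h h' h'' => hsub <|
    run_sound run_three_two_two hL (hcyc n _ _) (fun z hz _ => hmin z hz) (fun j _ hj => by
      interval_cases j
      · simpa [budget] using h
      · simpa [budget] using h'
      · exact h''
      · rw [hzero]
        · simp
        · push_cast; omega) (by simp) (by simp) (by subst hM2; exact hN)
  have f₉ : M = 1 → num L n ≤ 3 → ¬ num L (n + 1) ≤ 2 :=
    fun hM1 h h' => hsub <|
    run_sound run_three_two hL (hcyc n _ _) (fun z hz _ => hmin z hz) (fun j _ hj => by
      interval_cases j
      · simpa [budget] using h
      · simpa [budget] using h'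
      · rw [hzero]
        · simp
        · push_cast; omega) (by simp) (by simp) (by subst hM1; exact hN)
  refine .inr (.inr ⟨n, hn, hmin, ?_⟩)
  rw [hsum]
  have hc₀ : num L n = num L (n + (0 : ℕ)) := by simp
  have hc₁ : num L (n + 1) = num L (n + (1 : ℕ)) := rfl
  have hc₂ : num L (n + 2) = num L (n + (2 : ℕ)) := rfl
  have f₄' : ∀ l, l + 1 = M → num L (n + M) ≤ 3 → ¬ num L (n + l) ≤ 1 := by
    rintro l rfl
    rwa [show n + ((l + 1 : ℕ) : ℤ) - 1 = n + l by push_cast; ring] at f₄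
  have hz : ∀ l : ℕ, M < l → num L (n + l) = 0 := fun l hl => hzero _ (by omega)
  rw [hsum] at hcard
  rw [hc₀] at f₁ f₃ f₅ f₆ f₇ f₈ f₉ ⊢
  rw [hc₁] at f₃ f₆ f₇ f₈ f₉ ⊢
  rw [hc₂] at f₆ f₇ f₈
  exact shape_of_counts (fun l => num L (n + l)) hM6 hcard hgap hz f₁ f₂ f₃ f₄' f₅ f₆ f₇ f₈ f₉

theorem eta_eq_zero_of_card_le_five (m : ℕ) : ∀ L : Multiset STerm, L.card = m → m ≤ 5 →
    (∀ x ∈ L, x.Valid) → IsCyc L → eta L = 0 := by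
  induction m using Nat.strong_induction_on with
  | _ m ih =>
  intro L hm hm5 hL hc
  by_cases hne : L = 0
  · subst hne; rfl
  have key : ∀ C ≤ L, C ≠ 0 → IsCyc C → (eta C = 0 ∨ C ≠ L) → eta L = 0 := by
    intro C hC hC₀ hcC h
    obtain ⟨D, rfl⟩ := Multiset.le_iff_exists_add.1 hC
    have hpos := Multiset.card_pos.2 hC₀
    rw [Multiset.card_add] at hm
    have hD : eta D = 0 := ih D.card (by omega) D rfl (by omega)
      (fun x hx => hL x (Multiset.mem_add.2 (.inr hx))) (hc.of_add hcC)
    rw [eta_add, hD, add_zero]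
    rcases h with h | h
    · exact h
    · have hD₀ : D ≠ 0 := by rintro rfl; simp at h
      have := Multiset.card_pos.2 hD₀
      exact ih C.card (by omega) C rfl (by omega)
        (fun x hx => hL x (Multiset.mem_add.2 (.inl hx))) hcC
  rcases exists_null_or_split_or_shape hL hc hne (by omega) with
    ⟨C, hC, hC₀, hcC, h⟩ | ⟨C, hC, hC₀, h, hcC⟩ | ⟨n, h⟩
  · exact key C hC hC₀ hcC (.inl h)
  · exact key C hC hC₀ hcC (.inr h)
  · have := h.2.2.1
    omega

theorem one_lt_card_of_isCyc {L : Multiset STerm} (hL : ∀ x ∈ L, x.Valid) (hc : IsCyc L)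
    (hne : L ≠ 0) : 1 < L.card := by
  have hpos := Multiset.card_pos.2 hne
  by_contra h
  obtain ⟨x, rfl⟩ := Multiset.card_eq_one.1 (show L.card = 1 by omega)
  have hv := hL x (Multiset.mem_singleton_self x)
  have := hc x.d (x.u, x.a, x.b)
  have h₁ : coef x x.d (x.u, x.a, x.b) = -sg x.s := by
    simp [coef, fCoef, ind, hv.1, hv.1.symm, hv.2.symm]
  rw [← Multiset.cons_zero, cf_cons, cf_zero, h₁] at this
  cases h : x.s <;> simp [h, sg] at this

theorem exists_hasShape {L : Multiset STerm} (hL : ∀ x ∈ L, x.Valid) (hc : IsCyc L)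
    (hcard : L.card ≤ 7) (heta : eta L ≠ 0) : ∃ n, HasShape L n := by
  have hne : L ≠ 0 := by rintro rfl; exact heta rfl
  have key : ∀ C ≤ L, C ≠ 0 → IsCyc C → (eta C = 0 ∨ C ≠ L) → eta L = 0 := by
    intro C hC hC₀ hcC h
    obtain ⟨D, rfl⟩ := Multiset.le_iff_exists_add.1 hC
    have hvC : ∀ x ∈ C, x.Valid := fun x hx => hL x (Multiset.mem_add.2 (.inl hx))
    have hvD : ∀ x ∈ D, x.Valid := fun x hx => hL x (Multiset.mem_add.2 (.inr hx))
    have h₁ := one_lt_card_of_isCyc hvC hcC hC₀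
    rw [Multiset.card_add] at hcard
    rw [eta_add, eta_eq_zero_of_card_le_five _ D rfl (by omega) hvD (hc.of_add hcC), add_zero]
    rcases h with h | h
    · exact h
    · have hD₀ : D ≠ 0 := by rintro rfl; simp at h
      have h₂ := one_lt_card_of_isCyc hvD (hc.of_add hcC) hD₀
      exact eta_eq_zero_of_card_le_five _ C rfl (by omega) hvC hcC
  rcases exists_null_or_split_or_shape hL hc hne hcard with
    ⟨C, hC, hC₀, hcC, h⟩ | ⟨C, hC, hC₀, h, hcC⟩ | h
  · exact absurd (key C hC hC₀ hcC (.inl h)) heta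
  · exact absurd (key C hC hC₀ hcC (.inr h)) heta
  · exact h

theorem gen_apply {X S : Type*} [DecidableEq X] [DecidableEq S] (s : S) (l : List X)
    (k : Gen X S) : gen s l k = if s = k.1.1 ∧ l = k.1.2 then 1 else 0 := by
  obtain ⟨⟨s', l'⟩, hk⟩ := k
  unfold gen
  split_ifs with h₁ h₂ h₂
  · obtain ⟨rfl, rfl⟩ := h₂
    simp
  · refine Finsupp.single_eq_of_ne fun h => h₂ ?_
    have := congrArg Subtype.val h
    exact (Prod.mk.injEq .. ▸ this.symm)
  · obtain ⟨rfl, rfl⟩ := h₂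
    exact absurd hk h₁
  · rfl

/-- The generator `t` of length three, with a sign, as a term. -/
def ofGen (s : Bool) (t : Gen (Fin 6) (ℤ × Fin 6)) : STerm :=
  ⟨t.1.1.1, s, t.1.1.2, t.1.2.getD 0 0, t.1.2.getD 1 0, t.1.2.getD 2 0⟩

/-- The terms of a chain, with multiplicity. -/
noncomputable def terms (γ : Ch (Fin 6) (ℤ × Fin 6)) : Multiset STerm :=
  γ.sum fun t c => Multiset.replicate c.natAbs (ofGen (c < 0) t)

theorem card_terms (γ : Ch (Fin 6) (ℤ × Fin 6)) : (terms γ).card = chainLen γ := by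
  simp [terms, chainLen, Finsupp.sum]

theorem num_terms (γ : Ch (Fin 6) (ℤ × Fin 6)) (k : ℤ) : num (terms γ) k = Tcount γ k := by
  simp only [num, terms, Tcount, Finsupp.sum]
  rw [← Multiset.coe_countPAddMonoidHom, map_sum]
  refine Finset.sum_congr rfl fun t _ => ?_
  simp only [Multiset.coe_countPAddMonoidHom, Multiset.countP_eq_card_filter]
  split_ifs with h
  · rw [Multiset.filter_eq_self.2, Multiset.card_replicate]
    intro x hx
    rw [Multiset.eq_of_mem_replicate hx]; exact h
  · rw [Multiset.filter_eq_nil.2, Multiset.card_zero]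
    intro x hx
    rw [Multiset.eq_of_mem_replicate hx]; exact h

theorem mem_terms {γ : Ch (Fin 6) (ℤ × Fin 6)} {x : STerm} :
    x ∈ terms γ ↔ ∃ t ∈ γ.support, x = ofGen (γ t < 0) t := by
  simp only [terms, Finsupp.sum, Multiset.mem_sum, Multiset.mem_replicate]
  refine exists_congr fun t => and_congr_right fun ht => and_iff_right ?_
  simpa using ht

theorem exists_triple {S : Type*} {γ : Ch (Fin 6) S} (h3 : IsMChain 3 γ)
    {t : Gen (Fin 6) S} (ht : t ∈ γ.support) : ∃ s a b c h, t = ⟨(s, [a, b, c]), h⟩ := by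
  obtain ⟨⟨s, l⟩, h⟩ := t
  obtain ⟨a, b, c, rfl⟩ := List.length_eq_three.1 (h3 _ ht)
  exact ⟨s, a, b, c, h, rfl⟩

theorem chain_triple {X : Type*} {a b c : X} (h : [a, b, c].IsChain (· ≠ ·)) : a ≠ b ∧ b ≠ c := by
  simpa using h

theorem valid_of_mem_terms {γ : Ch (Fin 6) (ℤ × Fin 6)} (h3 : IsMChain 3 γ) :
    ∀ x ∈ terms γ, x.Valid := by
  intro x hx
  obtain ⟨t, ht, rfl⟩ := mem_terms.1 hx
  obtain ⟨s, a, b, c, h, rfl⟩ := exists_triple h3 ht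
  exact chain_triple h

theorem natAbs_mul_sg (c : ℤ) : (c.natAbs : ℤ) * sg (c < 0) = c := by
  unfold sg
  split_ifs with h <;> simp at h <;> omega

theorem bd_apply (γ : Ch (Fin 6) (ℤ × Fin 6)) (k : Gen (Fin 6) (ℤ × Fin 6)) :
    bd octAct (zact octAct) γ k =
      ∑ t ∈ γ.support, γ t * (fOn t k + gOn octAct (zact octAct) t k) := by
  simp [bd, fmap, gmap, Finsupp.sum, mul_add, Finset.sum_add_distrib]

theorem coef_eq (x : STerm) (e : ℤ) (K : Key) :
    coef x e K = sg x.s * coef { x with s := false } e K := by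
  simp [coef, fCoef, gCoef, sg]

theorem coef_ofGen {d e : ℤ} {u a b c v p q : Fin 6} (h) (hk : [p, q].IsChain (· ≠ ·)) :
    coef (ofGen false ⟨((d, u), [a, b, c]), h⟩) e (v, p, q) =
      fOn ⟨((d, u), [a, b, c]), h⟩ ⟨((e, v), [p, q]), hk⟩ +
        gOn octAct (zact octAct) ⟨((d, u), [a, b, c]), h⟩ ⟨((e, v), [p, q]), hk⟩ := by
  have hpq : p ≠ q := by simpa using hk
  have hind : ∀ w y z, ind w y z (v, p, q) = if w = v ∧ y = p ∧ z = q then 1 else 0 := by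
    intro w y z
    simp only [ind, Prod.mk.injEq]
    refine if_congr ⟨And.right, fun h => ⟨?_, h⟩⟩ rfl rfl
    rw [h.2.1, h.2.2]; exact hpq
  have hf : fOn (⟨((d, u), [a, b, c]), h⟩ : Gen (Fin 6) (ℤ × Fin 6)) =
      -gen (d, u) [b, c] + gen (d, u) [a, c] - gen (d, u) [a, b] := by
    simp [fOn, Fin.sum_univ_succ]
    abel
  have hg : gOn octAct (zact octAct) ⟨((d, u), [a, b, c]), h⟩ =
      gen (zact octAct (d, u) a) [b, c] - gen (zact octAct (d, u) b) [octAct a b, c] +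
        gen (zact octAct (d, u) c) [octAct a c, octAct b c] := by
    simp [gOn, Fin.sum_univ_succ]
    abel
  rw [hf, hg]
  simp only [Finsupp.add_apply, Finsupp.sub_apply, Finsupp.neg_apply, gen_apply, zact, coef, ofGen,
    fCoef, gCoef, hind, Prod.mk.injEq, List.cons.injEq, and_true, and_assoc]
  by_cases h₁ : d = e
  · have h₂ : d + 1 ≠ e := by omega
    simp [h₁, sg]
  · by_cases h₂ : d + 1 = e <;> simp [h₁, h₂, sg]

theorem cf_terms (γ : Ch (Fin 6) (ℤ × Fin 6)) (e : ℤ) (K : Key) :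
    cf (terms γ) e K = ∑ t ∈ γ.support, γ t * coef (ofGen false t) e K := by
  have : cf (terms γ) e K = ∑ t ∈ γ.support,
      ((Multiset.replicate (γ t).natAbs (ofGen (γ t < 0) t)).map fun x => coef x e K).sum := by
    simp only [cf, terms, Finsupp.sum]
    exact map_sum (Multiset.sumAddMonoidHom.comp (Multiset.mapAddMonoidHom fun x => coef x e K))
      _ _
  rw [this]
  refine Finset.sum_congr rfl fun t _ => ?_
  rw [Multiset.map_replicate, Multiset.sum_replicate, coef_eq (ofGen _ t), nsmul_eq_mul,
    ← mul_assoc]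
  exact congrArg (· * _) (natAbs_mul_sg _)

theorem isCyc_terms {γ : Ch (Fin 6) (ℤ × Fin 6)} (h3 : IsMChain 3 γ)
    (hcyc : bd octAct (zact octAct) γ = 0) : IsCyc (terms γ) := by
  rintro e ⟨v, p, q⟩
  rw [cf_terms]
  by_cases hpq : p = q
  · refine Finset.sum_eq_zero fun t _ => ?_
    have : ∀ w y z, ind w y z (v, p, q) = 0 := by
      intro w y z
      refine if_neg fun h => h.1 ?_
      simp only [Prod.mk.injEq] at h
      rw [h.2.2.1, h.2.2.2, hpq]
    simp [coef, fCoef, gCoef, this]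
  · have hk : [p, q].IsChain (· ≠ ·) := by simpa using hpq
    have := DFunLike.congr_fun hcyc ⟨((e, v), [p, q]), hk⟩
    rw [bd_apply] at this
    rw [Finsupp.zero_apply] at this
    rw [← this]
    refine Finset.sum_congr rfl fun t ht => ?_
    obtain ⟨⟨d, u⟩, a, b, c, h, rfl⟩ := exists_triple h3 ht
    rw [coef_ofGen]

theorem sig0_iterate_mod (k : ℕ) : sig0^[k] = sig0^[k % 4] := by
  have h : sig0^[4] = id := by decide
  conv_lhs => rw [← Nat.mod_add_div k 4, Function.iterate_add, Function.iterate_mul, h,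
    Function.iterate_id, Function.comp_id]

theorem exists_iterate_sig0 {P : (Fin 6 → Fin 6) → Prop} :
    (∃ k : ℕ, P sig0^[k]) ↔ ∃ k : Fin 4, P sig0^[k] :=
  ⟨fun ⟨k, h⟩ => ⟨⟨k % 4, Nat.mod_lt _ (by omega)⟩, sig0_iterate_mod k ▸ h⟩,
    fun ⟨k, h⟩ => ⟨k, h⟩⟩

theorem etaN_eq (a b c : Fin 6) : etaN a b c =
    if ∃ k : Fin 4, ∃ p ∈ etaTriples1, a = sig0^[k] p.1 ∧ b = sig0^[k] p.2.1 ∧ c = sig0^[k] p.2.2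
      then 1
    else if ∃ k : Fin 4, ∃ p ∈ etaTriples2,
      a = sig0^[k] p.1 ∧ b = sig0^[k] p.2.1 ∧ c = sig0^[k] p.2.2 then 2
    else 0 := by
  revert a b c
  decide +kernel

theorem etaFun_eq (a b c : Fin 6) : etaFun a b c = (etaN a b c : ZMod 3) := by
  rw [etaN_eq]
  unfold etaFun
  simp only [exists_iterate_sig0
    (P := fun s => ∃ p ∈ etaTriples1, a = s p.1 ∧ b = s p.2.1 ∧ c = s p.2.2),
    exists_iterate_sig0
    (P := fun s => ∃ p ∈ etaTriples2, a = s p.1 ∧ b = s p.2.1 ∧ c = s p.2.2)]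
  split_ifs <;> simp

theorem evalCh_gen {X A : Type*} [AddCommGroup A] (θ : List X → A) {l : List X}
    (h : l.IsChain (· ≠ ·)) : evalCh θ (gen () l) = θ l := by
  simp [evalCh, show gen () l = Finsupp.single ⟨((), l), h⟩ 1 from dif_pos h]

/-- `evalCh θ`, as a homomorphism. -/
noncomputable def evalHom {X A : Type*} [AddCommGroup A] (θ : List X → A) : Ch X Unit →+ A :=
  Finsupp.liftAddHom fun t => (zmultiplesHom A) (θ t.1.2)

theorem evalHom_apply {X A : Type*} [AddCommGroup A] (θ : List X → A) (δ : Ch X Unit) :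
    evalHom θ δ = evalCh θ δ := rfl

theorem eta_terms {γ : Ch (Fin 6) (ℤ × Fin 6)} (h3 : IsMChain 3 γ) :
    eta (terms γ) = evalCh etaL (proj γ) := by
  have : eta (terms γ) = ∑ t ∈ γ.support,
      ((Multiset.replicate (γ t).natAbs (ofGen (γ t < 0) t)).map (etaT [])).sum := by
    simp only [eta, etaM, terms, Finsupp.sum]
    exact map_sum (Multiset.sumAddMonoidHom.comp (Multiset.mapAddMonoidHom (etaT []))) _ _
  rw [this, ← evalHom_apply, proj, Finsupp.sum, map_sum]
  refine Finset.sum_congr rfl fun t ht => ?_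
  rw [map_zsmul, evalHom_apply, evalCh_gen _ t.2, Multiset.map_replicate, Multiset.sum_replicate,
    nsmul_eq_mul, zsmul_eq_mul]
  obtain ⟨s, a, b, c, h, rfl⟩ := exists_triple h3 ht
  conv_rhs => rw [← natAbs_mul_sg (γ _), Int.cast_mul, Int.cast_natCast, mul_assoc]
  simp only [etaT, ofGen, etaL, etaFun_eq]
  rfl

theorem octAct_left_injective (b : Fin 6) : Function.Injective fun a => octAct a b := by
  revert b; decide

theorem octAct_self (a : Fin 6) : octAct a a = a := by
  revert a; decide

theorem foldl_octAct_injective (l : List (Fin 6)) : Function.Injective fun a => l.foldl octAct a := by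
  induction l with
  | nil => exact Function.injective_id
  | cons b l ih => exact ih.comp (octAct_left_injective b)

theorem revList_injective : Function.Injective (revList octAct) := by
  intro l
  induction l with
  | nil => intro l' h; cases l' <;> simp_all [revList]
  | cons a l ih =>
    rintro (_ | ⟨a', l'⟩) h
    · simp [revList] at h
    · simp only [revList, List.cons.injEq] at h
      obtain rfl := ih h.2
      rw [foldl_octAct_injective l h.1]

theorem isChain_revList {l : List (Fin 6)} (h : l.IsChain (· ≠ ·)) :
    (revList octAct l).IsChain (· ≠ ·) := by
  induction l with
  | nil => exact h
  | cons a l ih =>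
    cases l with
    | nil => simp [revList]
    | cons b l =>
      rw [List.isChain_cons_cons] at h
      refine List.isChain_cons_cons.2 ⟨fun e => h.1 ?_, ih h.2⟩
      refine octAct_left_injective b ((foldl_octAct_injective l e).trans ?_)
      exact (octAct_self b).symm

/-- The reverse of a generator. -/
def revGen (t : Gen (Fin 6) (ℤ × Fin 6)) : Gen (Fin 6) (ℤ × Fin 6) :=
  ⟨((-t.1.1.1, t.1.2.foldl octAct t.1.1.2), revList octAct t.1.2), isChain_revList t.2⟩

theorem revGen_injective : Function.Injective revGen := by
  rintro ⟨⟨⟨d, u⟩, l⟩, h⟩ ⟨⟨⟨d', u'⟩, l'⟩, h'⟩ e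
  have e₀ : -d = -d' := congrArg (·.1.1.1) e
  have e₁ : l.foldl octAct u = l'.foldl octAct u' := congrArg (·.1.1.2) e
  have e₂ : revList octAct l = revList octAct l' := congrArg (·.1.2) e
  obtain rfl := neg_inj.1 e₀
  obtain rfl := revList_injective e₂
  obtain rfl := foldl_octAct_injective l e₁
  rfl

theorem reverse_eq (γ : Ch (Fin 6) (ℤ × Fin 6)) : reverse octAct γ = γ.mapDomain revGen := by
  refine Finset.sum_congr rfl fun t _ => ?_
  have h : gen _ _ = Finsupp.single (revGen t) 1 := dif_pos (revGen t).2
  exact (congrArg (γ t • ·) h).trans (by simp)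

theorem Tcount_reverse (γ : Ch (Fin 6) (ℤ × Fin 6)) (k : ℤ) :
    Tcount (reverse octAct γ) k = Tcount γ (-k) := by
  rw [reverse_eq, Tcount, Finsupp.sum_mapDomain_index_inj revGen_injective]
  simp only [revGen, neg_eq_iff_eq_neg]
  rfl

theorem mem_support_reverse {γ : Ch (Fin 6) (ℤ × Fin 6)} {t : Gen (Fin 6) (ℤ × Fin 6)} :
    t ∈ (reverse octAct γ).support ↔ ∃ t' ∈ γ.support, revGen t' = t := by
  classical
  rw [reverse_eq, Finsupp.mapDomain_support_of_injective revGen_injective, Finset.mem_image]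

theorem degree_mem_terms {γ : Ch (Fin 6) (ℤ × Fin 6)} {t : Gen (Fin 6) (ℤ × Fin 6)}
    (ht : t ∈ γ.support) {P : ℤ → Prop} (h : ∀ x ∈ terms γ, P x.d) : P t.1.1.1 :=
  h _ (mem_terms.2 ⟨t, ht, rfl⟩)

theorem exists_degree_eq {γ : Ch (Fin 6) (ℤ × Fin 6)} {n : ℤ} (h : num (terms γ) n ≠ 0) :
    ∃ t ∈ γ.support, t.1.1.1 = n := by
  obtain ⟨x, hx, hd⟩ := Multiset.countP_pos.1 (Nat.pos_of_ne_zero h)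
  obtain ⟨t, ht, rfl⟩ := mem_terms.1 hx
  exact ⟨t, ht, hd⟩

/-- Two layers which contain all terms of a multiset. -/
theorem d_eq_or_of_num_add {L : Multiset STerm} {n : ℤ} (h : num L n + num L (n + 1) = L.card) :
    ∀ x ∈ L, x.d = n ∨ x.d = n + 1 := by
  have h₁ : num L n + num L (n + 1) = L.countP fun x => x.d = n ∨ x.d = n + 1 := by
    clear h
    unfold num
    induction L using Multiset.induction with
    | empty => rfl
    | cons x L ih =>
      simp only [Multiset.countP_cons, ← ih]
      by_cases h₁ : x.d = n
      · simp [h₁]; omega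
      · by_cases h₂ : x.d = n + 1 <;> simp [h₁, h₂]; omega
  exact Multiset.countP_eq_card.1 (h₁.symm.trans h)

theorem minDegree_of_hasShape {γ : Ch (Fin 6) (ℤ × Fin 6)} {n : ℤ} (h : HasShape (terms γ) n) :
    MinDegree γ n :=
  ⟨exists_degree_eq h.1, fun _ ht => degree_mem_terms ht h.2.1⟩

end Search

/-- shape of short 3-cycles of `(O₆, ℤ × O₆)` with nonzero `η`-weight,
up to reverse. -/
theorem cycle_shape_O6 (γ : Ch (Fin 6) (ℤ × Fin 6))
    (h3 : IsMChain 3 γ) (hcyc : bd octAct (zact octAct) γ = 0)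
    (hl1 : 1 ≤ chainLen γ) (hl7 : chainLen γ ≤ 7)
    (heta : evalCh etaL (proj γ) ≠ 0) :
    (∃ n, MinDegree γ n ∧ Shape γ n (chainLen γ)) ∨
    (∃ n, MinDegree (reverse octAct γ) n ∧ Shape (reverse octAct γ) n (chainLen γ)) := by
  open Search in
  obtain ⟨n, hn⟩ := exists_hasShape (valid_of_mem_terms h3) (isCyc_terms h3 hcyc)
    (card_terms γ ▸ hl7) (eta_terms h3 ▸ heta)
  have hmin := minDegree_of_hasShape hn
  obtain ⟨h₁, h₂, h₃, h₄⟩ := hn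
  simp only [card_terms] at h₃ h₄
  rcases h₄ with h₄ | ⟨h₄, h₅⟩
  · refine .inl ⟨n, hmin, .inl ⟨by omega, hl7, ?_⟩⟩
    rw [← num_terms, h₄]
  by_cases h₆ : num (terms γ) n = 2 ∨ num (terms γ) n = 3
  · refine .inl ⟨n, hmin, .inr ?_⟩
    rw [← num_terms, ← num_terms]
    rcases h₆ with h₆ | h₆
    · exact .inl ⟨h₃, hl7, h₆, by omega⟩
    · exact .inr ⟨h₃, hl7, h₆, by omega⟩
  · refine .inr ⟨-(n + 1), ⟨?_, fun t ht => ?_⟩, .inr ?_⟩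
    · obtain ⟨t, ht, hd⟩ := exists_degree_eq (γ := γ) (n := n + 1) (by omega)
      exact ⟨revGen t, mem_support_reverse.2 ⟨t, ht, rfl⟩, congrArg Neg.neg hd⟩
    · obtain ⟨t, ht', rfl⟩ := mem_support_reverse.1 ht
      have := degree_mem_terms (P := fun d => d = n ∨ d = n + 1) ht'
        (d_eq_or_of_num_add (by rw [card_terms, h₄]))
      change _ ≤ -t.1.1.1
      omega
    · rw [Tcount_reverse, Tcount_reverse, show -(-(n + 1)) = n + 1 by ring,
        show -(-(n + 1) + 1) = n by ring, ← num_terms, ← num_terms]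
      rcases h₅ with h₅ | h₅ | h₅ | h₅
      · exact absurd (.inl h₅) h₆
      · exact absurd (.inr h₅) h₆
      · exact .inl ⟨h₃, hl7, h₅, by omega⟩
      · exact .inr ⟨h₃, hl7, h₅, by omega⟩

end QHom
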